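/- arXiv:1812.11885 — 2 statements merged into one kernel-verified Lean document; each statement's English description precedes it below -/
import Mathlib

section
/- (Do–Norbury recursion for dessins d'enfant) Let γ = (1 2 … d) be the standard d-cycle in S_d, and for integers g ≥ 0 and d ≥ 1 let b_g(d) be the number of pairs (σ₁, σ₂) ∈ S_d × S_d with σ₁∘σ₂ = γ and c(σ₁) + c(σ₂) = d+1−2g, where c(σ) denotes the number of cycles of σ (this counts genus-g dessins d'enfant with one face of degree 2d). With the convention b_g(d) = 0 for g < 0, for all integers g ≥ 0 and d ≥ 3 one has (d+1)·b_g(d) = 2(2d−1)·b_g(d−1) + (d−1)²(d−2)·b_{g−1}(d−2). -/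
/-- The number of cycles of a permutation of `Fin n`, counting fixed points as cycles. -/
def cycleCount {n : ℕ} (σ : Equiv.Perm (Fin n)) : ℕ :=
  Multiset.card σ.cycleType + (n - σ.cycleType.sum)

/-- `b g d` is the number of pairs `(σ₁, σ₂)` of permutations in the symmetric group on
`d` letters with `σ₁ ∘ σ₂ = γ` (the standard `d`-cycle) and `c(σ₁) + c(σ₂) = d + 1 - 2g`;
by convention it is `0` for `g < 0`. -/
noncomputable def b (g : ℤ) (d : ℕ) : ℤ :=
  if g < 0 then 0 else
    (Nat.card {p : Equiv.Perm (Fin d) × Equiv.Perm (Fin d) //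
      p.1 * p.2 = finRotate d ∧
      ((cycleCount p.1 : ℤ) + (cycleCount p.2 : ℤ)) = (d : ℤ) + 1 - 2 * g} : ℤ)

section Factorizations

open Equiv Finset

theorem card_quotient_sameCycle {n : ℕ} (σ : Perm (Fin n)) :
    Nat.card (Quotient (Perm.SameCycle.setoid σ)) = cycleCount σ := by
  classical
  have key : Nat.card (Quotient (Perm.SameCycle.setoid σ)) =
      Nat.card (σ.cycleFactorsFinset ⊕ {x // x ∉ σ.support}) := by
    let φ : Fin n → σ.cycleFactorsFinset ⊕ {x // x ∉ σ.support} := fun x =>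
      if h : x ∈ σ.support then Sum.inl ⟨σ.cycleOf x, Perm.cycleOf_mem_cycleFactorsFinset_iff.2 h⟩
      else Sum.inr ⟨x, h⟩
    have hφ : ∀ x y, σ.SameCycle x y ↔ φ x = φ y := by
      intro x y
      by_cases hx : x ∈ σ.support <;> by_cases hy : y ∈ σ.support
      · simp only [φ, hx, hy, dite_true, Sum.inl.injEq, Subtype.mk.injEq]
        exact ⟨fun h => h.cycleOf_eq, fun h => by
          have h1 : y ∈ (σ.cycleOf x).support := by
            rw [h, Perm.mem_support_cycleOf_iff]; exact ⟨Perm.SameCycle.refl _ _, hy⟩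
          exact (Perm.mem_support_cycleOf_iff.1 h1).1⟩
      · simp only [φ, hx, hy, dite_true, dite_false, reduceCtorEq, iff_false]
        intro h
        exact hy (Perm.mem_support.2 fun h2 => Perm.mem_support.1 hx (h.apply_eq_self_iff.2 h2))
      · simp only [φ, hx, hy, dite_true, dite_false, reduceCtorEq, iff_false]
        intro h
        exact hx (Perm.mem_support.2 fun h2 => Perm.mem_support.1 hy (h.apply_eq_self_iff.1 h2))
      · simp only [φ, hx, hy, dite_false, Sum.inr.injEq, Subtype.mk.injEq]
        exact ⟨fun h => (h.eq_of_left (Perm.notMem_support.1 hx)), fun h => h ▸ Perm.SameCycle.refl _ _⟩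
    refine Nat.card_eq_of_bijective (Quotient.lift φ fun x y h => (hφ x y).1 h) ⟨?_, ?_⟩
    · rintro ⟨x⟩ ⟨y⟩ h
      exact Quotient.sound ((hφ x y).2 h)
    · rintro (⟨c, hc⟩ | ⟨x, hx⟩)
      · obtain ⟨x, hx⟩ := (Perm.mem_cycleFactorsFinset_iff.1 hc).1.nonempty_support
        refine ⟨Quotient.mk _ x, ?_⟩
        have hx' : x ∈ σ.support := Perm.mem_cycleFactorsFinset_support_le hc hx
        simp only [Quotient.lift_mk, φ, hx', dite_true, Sum.inl.injEq, Subtype.mk.injEq]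
        exact (Perm.cycle_is_cycleOf hx hc).symm
      · exact ⟨Quotient.mk _ x, by simp only [Quotient.lift_mk, φ, hx, dite_false]⟩
  rw [key, Nat.card_sum, Nat.card_eq_fintype_card, Nat.card_eq_fintype_card, cycleCount,
    Perm.sum_cycleType, Fintype.card_coe, Perm.cycleType_def, Multiset.card_map]
  congr 1
  rw [Fintype.card_subtype_compl, Fintype.card_fin, Fintype.card_coe]

theorem card_invariant_colorings {n : ℕ} (σ : Perm (Fin n)) (N : ℕ) :
    Nat.card {f : Fin n → Fin N // ∀ x, f (σ x) = f x} = N ^ cycleCount σ := by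
  classical
  have hf : ∀ f : Fin n → Fin N, (∀ x, f (σ x) = f x) → ∀ x y, σ.SameCycle x y → f x = f y := by
    intro f h x y hxy
    obtain ⟨i, -, rfl⟩ := hxy.exists_pow_eq'
    clear hxy
    induction i with
    | zero => rfl
    | succ i ih => rw [pow_succ', Perm.mul_apply, h, ← ih]
  let e : {f : Fin n → Fin N // ∀ x, f (σ x) = f x} ≃
      (Quotient (Perm.SameCycle.setoid σ) → Fin N) :=
    { toFun := fun f => Quotient.lift f.1 (hf f.1 f.2)
      invFun := fun f => ⟨fun x => f (Quotient.mk _ x), fun x => congrArg f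
        (Quotient.sound (Perm.sameCycle_apply_left.2 (Perm.SameCycle.refl σ x)))⟩
      left_inv := fun f => rfl
      right_inv := fun f => by ext ⟨x⟩; rfl }
  rw [Nat.card_congr e, Nat.card_fun, Nat.card_fin, card_quotient_sameCycle]

theorem cycleCount_mul_swap {n : ℕ} (τ : Perm (Fin n)) {i t : Fin n} (ht : τ t = t)
    (hit : i ≠ t) : cycleCount (τ * swap i t) + 1 = cycleCount τ := by
  refine Nat.pow_right_injective le_rfl (?_ : 2 ^ _ = 2 ^ _)
  rw [pow_succ, ← card_invariant_colorings, ← card_invariant_colorings, ← Nat.card_fin 2,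
    ← Nat.card_prod, Nat.card_fin]
  have hinv : ∀ f : Fin n → Fin 2, (∀ x, f ((τ * swap i t) x) = f x) ↔
      (∀ x, f (τ x) = f x) ∧ f t = f i := by
    intro f
    have hs : f t = f i → ∀ x, f (swap i t x) = f x := by
      intro h x
      rcases eq_or_ne x i with rfl | hxi
      · simpa using h
      rcases eq_or_ne x t with rfl | hxt
      · simpa using h.symm
      · rw [swap_apply_of_ne_of_ne hxi hxt]
    constructor
    · intro h
      have h1 : f t = f i := by simpa [ht] using h i
      refine ⟨fun x => ?_, h1⟩
      have := h (swap i t x)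
      rwa [Perm.mul_apply, swap_apply_self, hs h1] at this
    · rintro ⟨h, h1⟩ x
      rw [Perm.mul_apply, h, hs h1]
  have hne : ∀ x, x ≠ t → τ x ≠ t := fun x hx h => hx (τ.injective (h.trans ht.symm))
  refine Nat.card_eq_of_bijective (fun p => ⟨Function.update p.1.1 t p.2, ?_⟩) ⟨?_, ?_⟩
  · intro x
    rcases eq_or_ne x t with rfl | hx
    · rw [ht]
    · rw [Function.update_of_ne hx, Function.update_of_ne (hne x hx)]
      exact ((hinv _).1 p.1.2).1 x
  · rintro ⟨⟨f, hf⟩, a⟩ ⟨⟨g, hg⟩, a'⟩ h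
    simp only [Subtype.mk.injEq] at h
    have ha : a = a' := by simpa using congrFun h t
    have hfg : ∀ x, x ≠ t → f x = g x := fun x hx => by simpa [hx] using congrFun h x
    have : f = g := by
      ext x
      rcases eq_or_ne x t with rfl | hx
      · rw [((hinv _).1 hf).2, ((hinv _).1 hg).2, hfg i hit]
      · rw [hfg x hx]
    subst this ha
    rfl
  · rintro ⟨f, hf⟩
    refine ⟨⟨⟨Function.update f t (f i), (hinv _).2 ⟨fun x => ?_, ?_⟩⟩, f t⟩, ?_⟩
    · rcases eq_or_ne x t with rfl | hx
      · rw [ht]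
      · rw [Function.update_of_ne hx, Function.update_of_ne (hne x hx), hf]
    · simp [hit]
    · simp

/-- The alternating sum over hook shapes which evaluates the one-face generating polynomial. -/
def hookSum (n : ℕ) (x : ℚ) : ℚ :=
  ∑ k ∈ range n, (-1) ^ k * ((n - 1).choose k : ℚ) * (∏ j ∈ range n, (x - k + j)) ^ 2

theorem hookSum_recursion (m : ℕ) (x : ℚ) :
    (m + 4 : ℚ) * hookSum (m + 3) x =
      2 * (2 * m + 5) * (m + 3) * x * hookSum (m + 2) x +
        (m + 1) * (m + 2) ^ 3 * (m + 3) * hookSum (m + 1) x := by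
  set G : ℕ → ℚ := fun k => (-1) ^ k * ((m + 2).choose k : ℚ) * k *
    ((m + 2) * k ^ 2 - (m + 2) * (3 * m + 7) * k + 2 * x * k + (2 * m + 5) * (m + 2) ^ 2
      - 2 * (m + 2) * x - (m + 4) * x ^ 2) * (∏ j ∈ range (m + 2), (x - k + j)) ^ 2 with hG
  have e2 : hookSum (m + 2) x = ∑ k ∈ range (m + 3),
      (-1) ^ k * ((m + 1).choose k : ℚ) * (∏ j ∈ range (m + 2), (x - k + j)) ^ 2 := by
    rw [sum_range_succ, Nat.choose_succ_self]; simp [hookSum]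
  have e3 : hookSum (m + 1) x = ∑ k ∈ range (m + 3),
      (-1) ^ k * (m.choose k : ℚ) * (∏ j ∈ range (m + 1), (x - k + j)) ^ 2 := by
    rw [sum_range_succ, sum_range_succ, Nat.choose_succ_self,
      Nat.choose_eq_zero_of_lt (show m < m + 2 by omega)]; simp [hookSum]
  have tele : ∑ k ∈ range (m + 3), (G (k + 1) - G k) = 0 := by
    rw [sum_range_sub]
    simp [hG, Nat.choose_succ_self]
  have c0 : ∀ a k : ℕ, ((a + 1).choose k : ℚ) * (a + 1 - k) = (a + 1) * (a.choose k : ℚ) := by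
    intro a k
    rcases le_or_gt k (a + 1) with h | h
    · have := Nat.choose_mul_succ_eq a k
      have h2 : ((a + 1 - k : ℕ) : ℚ) = a + 1 - k := by push_cast [Nat.cast_sub h]; ring
      rw [← h2]; exact_mod_cast (by linarith : (a + 1).choose k * (a + 1 - k) = (a + 1) * a.choose k)
    · rw [Nat.choose_eq_zero_of_lt h, Nat.choose_eq_zero_of_lt (by omega : a < k)]; simp
  have c1 : ∀ a k : ℕ, (a.choose (k + 1) : ℚ) * (k + 1) = (a.choose k : ℚ) * (a - k) := by
    intro a k
    rcases le_or_gt k a with h | h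
    · have := Nat.choose_succ_right_eq a k
      have h2 : ((a - k : ℕ) : ℚ) = a - k := by push_cast [Nat.cast_sub h]; ring
      rw [← h2]; exact_mod_cast this
    · rw [Nat.choose_eq_zero_of_lt h, Nat.choose_eq_zero_of_lt (by omega : a < k + 1)]; simp
  have main : ∀ k ∈ range (m + 3),
      (m + 2 : ℚ) * ((m + 4 : ℚ) * ((-1) ^ k * ((m + 2).choose k : ℚ) *
          (∏ j ∈ range (m + 3), (x - k + j)) ^ 2) -
        2 * (2 * m + 5) * (m + 3) * x *
          ((-1) ^ k * ((m + 1).choose k : ℚ) * (∏ j ∈ range (m + 2), (x - k + j)) ^ 2) -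
        (m + 1) * (m + 2) ^ 3 * (m + 3) *
          ((-1) ^ k * (m.choose k : ℚ) * (∏ j ∈ range (m + 1), (x - k + j)) ^ 2)) =
      G (k + 1) - G k := by
    intro k _
    have p2 : ∏ j ∈ range (m + 2), (x - k + j) =
        (∏ j ∈ range (m + 1), (x - k + j)) * (x - k + (m + 1)) := by
      rw [prod_range_succ]; push_cast; ring
    have p3 : ∏ j ∈ range (m + 3), (x - k + j) =
        (∏ j ∈ range (m + 1), (x - k + j)) * (x - k + (m + 1)) * (x - k + (m + 2)) := by
      rw [prod_range_succ, p2]; push_cast; ring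
    have p2' : ∏ j ∈ range (m + 2), (x - (k + 1 : ℕ) + j) =
        (∏ j ∈ range (m + 1), (x - k + j)) * (x - k - 1) := by
      rw [prod_range_succ']
      congr 1
      · exact prod_congr rfl fun j _ => by push_cast; ring
      · push_cast; ring
    simp only [hG]
    rw [p3, p2, p2']
    have h1 := c1 (m + 2) k
    have h2 := c0 (m + 1) k
    have h3 := c0 m k
    push_cast at h1 h2 h3 ⊢
    set P := ∏ j ∈ range (m + 1), (x - k + j)
    rw [pow_succ (-1 : ℚ) k]
    set ε := (-1 : ℚ) ^ k
    have h2' : ((m + 1).choose k : ℚ) = (m + 2).choose k * (m + 2 - k) / (m + 2) := by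
      field_simp; linarith
    have h3' : (m.choose k : ℚ) = (m + 1).choose k * (m + 1 - k) / (m + 1) := by
      field_simp; linarith
    rw [h3', h2']
    have hm1 : (m + 1 : ℚ) ≠ 0 := by positivity
    have hm2 : (m + 2 : ℚ) ≠ 0 := by positivity
    rw [mul_assoc (ε * -1) (((m + 2).choose (k + 1) : ℕ) : ℚ) ((k : ℚ) + 1), h1]
    field_simp
    ring
  have := sum_congr rfl main
  rw [tele, ← mul_sum, sum_sub_distrib, sum_sub_distrib, ← mul_sum, ← mul_sum, ← mul_sum,
    ← e2, ← e3] at this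
  have hm2 : (m + 2 : ℚ) ≠ 0 := by positivity
  have := (mul_eq_zero.1 this).resolve_left hm2
  have e1 : hookSum (m + 3) x = ∑ k ∈ range (m + 3), (-1) ^ k * ((m + 2).choose k : ℚ) *
    (∏ j ∈ range (m + 3), (x - k + j)) ^ 2 := rfl
  rw [← e1] at this
  linarith

theorem pow_mul_prod_range (x : ℚ) (q : ℕ) (f : ℕ → ℚ) :
    x ^ q * ∏ j ∈ range q, f j = ∏ j ∈ range q, x * f j := by
  rw [prod_mul_distrib, prod_const, card_range]

section HookIdempotent
variable {α : Type*} [Fintype α] [DecidableEq α]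

/-- The permutations supported in `T`. -/
def permsOn (T : Finset α) : Finset (Perm α) := univ.filter fun σ => ∀ x, x ∉ T → σ x = x

theorem mem_permsOn {T : Finset α} {σ : Perm α} : σ ∈ permsOn T ↔ ∀ x, x ∉ T → σ x = x := by
  simp [permsOn]

theorem permsOn_empty : permsOn (∅ : Finset α) = {1} := by
  ext σ
  simp [mem_permsOn, Equiv.ext_iff]

theorem permsOn_univ : permsOn (univ : Finset α) = univ := by
  ext σ
  simp [mem_permsOn]

theorem apply_mem_of_mem_permsOn {T : Finset α} {σ : Perm α} (h : σ ∈ permsOn T) {x : α} :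
    σ x ∈ T ↔ x ∈ T := by
  rw [mem_permsOn] at h
  constructor
  · intro h1
    by_contra h2
    exact h2 (h x h2 ▸ h1)
  · intro h1
    by_contra h2
    exact h2 ((σ.injective (h _ h2)).symm ▸ h1)

theorem swap_mem_permsOn {T : Finset α} {i j : α} (hi : i ∈ T) (hj : j ∈ T) :
    swap i j ∈ permsOn T := by
  rw [mem_permsOn]
  intro x hx
  exact swap_apply_of_ne_of_ne (fun h => hx (h ▸ hi)) (fun h => hx (h ▸ hj))

theorem mul_mem_permsOn {T : Finset α} {σ τ : Perm α} (hσ : σ ∈ permsOn T) (hτ : τ ∈ permsOn T) :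
    σ * τ ∈ permsOn T := by
  rw [mem_permsOn] at *
  intro x hx
  rw [Perm.mul_apply, hτ x hx, hσ x hx]

theorem sum_permsOn_mul_swap {M : Type*} [AddCommMonoid M] {T : Finset α} {i j : α} (hi : i ∈ T)
    (hj : j ∈ T) (g : Perm α → M) :
    ∑ σ ∈ permsOn T, g (σ * swap i j) = ∑ σ ∈ permsOn T, g σ := by
  refine sum_nbij' (· * swap i j) (· * swap i j) ?_ ?_ ?_ ?_ ?_
  · exact fun σ hσ => mul_mem_permsOn hσ (swap_mem_permsOn hi hj)
  · exact fun σ hσ => mul_mem_permsOn hσ (swap_mem_permsOn hi hj)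
  · simp [mul_assoc]
  · simp [mul_assoc]
  · simp

theorem sum_permsOn_swap_mul {M : Type*} [AddCommMonoid M] {T : Finset α} {i j : α} (hi : i ∈ T)
    (hj : j ∈ T) (g : Perm α → M) :
    ∑ σ ∈ permsOn T, g (swap i j * σ) = ∑ σ ∈ permsOn T, g σ := by
  refine sum_nbij' (swap i j * ·) (swap i j * ·) ?_ ?_ ?_ ?_ ?_
  · exact fun σ hσ => mul_mem_permsOn (swap_mem_permsOn hi hj) hσ
  · exact fun σ hσ => mul_mem_permsOn (swap_mem_permsOn hi hj) hσ
  · simp [← mul_assoc]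
  · simp [← mul_assoc]
  · simp

theorem sum_permsOn_insert {M : Type*} [AddCommMonoid M] {T : Finset α} {t : α} (ht : t ∉ T)
    (g : Perm α → M) :
    ∑ σ ∈ permsOn (insert t T), g σ =
      ∑ σ ∈ permsOn T, g σ + ∑ i ∈ T, ∑ σ ∈ permsOn T, g (σ * swap i t) := by
  have h1 : ∑ σ ∈ permsOn (insert t T), g σ =
      ∑ i ∈ insert t T, ∑ σ ∈ permsOn T, g (σ * swap i t) := by
    rw [← sum_product']
    refine sum_nbij' (fun σ => (σ⁻¹ t, σ * swap (σ⁻¹ t) t)) (fun p => p.2 * swap p.1 t)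
      ?_ ?_ ?_ ?_ ?_
    · intro σ hσ
      have hm : σ⁻¹ t ∈ insert t T := by
        rw [← apply_mem_of_mem_permsOn hσ]; simp
      rw [mem_product]
      refine ⟨hm, mem_permsOn.2 fun x hx => ?_⟩
      rcases eq_or_ne x t with rfl | hxt
      · simp
      · exact mem_permsOn.1 (mul_mem_permsOn hσ (swap_mem_permsOn hm (mem_insert_self t T))) x
          (by simp [hx, hxt])
    · rintro ⟨i, σ⟩ h
      rw [mem_product] at h
      refine mul_mem_permsOn (mem_permsOn.2 fun x hx => ?_)
        (swap_mem_permsOn h.1 (mem_insert_self t T))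
      exact mem_permsOn.1 h.2 x fun h2 => hx (mem_insert_of_mem h2)
    · intro σ _
      simp [mul_assoc]
    · rintro ⟨i, σ⟩ h
      rw [mem_product] at h
      have hst : σ.symm t = t := by
        rw [symm_apply_eq]; exact (mem_permsOn.1 h.2 t ht).symm
      simp [hst, mul_assoc]
    · intro σ _
      simp [mul_assoc]
  rw [h1, sum_insert ht]
  simp [← Perm.one_def]

/-- The group algebra element of a permutation. -/
noncomputable abbrev permElt (σ : Perm α) : MonoidAlgebra ℚ (Perm α) := MonoidAlgebra.of ℚ _ σ

/-- The sum of the transpositions exchanging `t` with an element of `T`. -/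
noncomputable def jucysMurphy (T : Finset α) (t : α) : MonoidAlgebra ℚ (Perm α) :=
  ∑ i ∈ T, permElt (swap i t)

/-- The symmetrizer of `T`. -/
noncomputable def symmetrizer (T : Finset α) : MonoidAlgebra ℚ (Perm α) :=
  ∑ σ ∈ permsOn T, permElt σ

/-- The antisymmetrizer of `T`. -/
noncomputable def antisymmetrizer (T : Finset α) : MonoidAlgebra ℚ (Perm α) :=
  ∑ σ ∈ permsOn T, ((Perm.sign σ : ℤ) : ℚ) • permElt σ

theorem swap_mul_symmetrizer {T : Finset α} {i j : α} (hi : i ∈ T) (hj : j ∈ T) :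
    permElt (swap i j) * symmetrizer T = symmetrizer T := by
  rw [symmetrizer, mul_sum, ← sum_permsOn_swap_mul hi hj permElt]
  exact sum_congr rfl fun σ _ => (map_mul _ _ _).symm

theorem swap_mul_antisymmetrizer {T : Finset α} {i j : α} (hi : i ∈ T) (hj : j ∈ T) (hij : i ≠ j) :
    permElt (swap i j) * antisymmetrizer T = -antisymmetrizer T := by
  rw [antisymmetrizer, mul_sum,
    ← sum_permsOn_swap_mul hi hj fun σ => ((Perm.sign σ : ℤ) : ℚ) • permElt σ, ← sum_neg_distrib]
  refine sum_congr rfl fun σ _ => ?_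
  simp [Perm.sign_swap hij]

theorem antisymmetrizer_mul_swap {T : Finset α} {i j : α} (hi : i ∈ T) (hj : j ∈ T) (hij : i ≠ j) :
    antisymmetrizer T * permElt (swap i j) = -antisymmetrizer T := by
  rw [antisymmetrizer, sum_mul,
    ← sum_permsOn_mul_swap hi hj fun σ => ((Perm.sign σ : ℤ) : ℚ) • permElt σ, ← sum_neg_distrib]
  refine sum_congr rfl fun σ _ => ?_
  simp [Perm.sign_swap hij]

theorem antisymmetrizer_insert {T : Finset α} {t : α} (ht : t ∉ T) :
    antisymmetrizer (insert t T) = antisymmetrizer T * (1 - jucysMurphy T t) := by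
  rw [antisymmetrizer, sum_permsOn_insert ht, mul_sub, mul_one, sub_eq_add_neg, jucysMurphy,
    mul_sum, ← sum_neg_distrib]
  congr 1
  refine sum_congr rfl fun i hi => ?_
  rw [antisymmetrizer, sum_mul, ← sum_neg_distrib]
  refine sum_congr rfl fun σ _ => ?_
  have hit : i ≠ t := fun h => ht (h ▸ hi)
  simp [Perm.sign_swap hit]

theorem jucysMurphy_mul_antisymmetrizer {T B : Finset α} {t : α} (hT : T ⊆ B) (htB : t ∈ B)
    (ht : t ∉ T) :
    jucysMurphy T t * antisymmetrizer B = (-(#T : ℚ)) • antisymmetrizer B := by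
  rw [jucysMurphy, sum_mul, sum_congr rfl fun i hi =>
    swap_mul_antisymmetrizer (hT hi) htB fun h => ht (h ▸ hi)]
  simp [← Nat.cast_smul_eq_nsmul ℚ]

theorem jucysMurphy_mul_symmetrizer {T B : Finset α} {t : α} (hT : T ⊆ B) (htB : t ∈ B) :
    jucysMurphy T t * symmetrizer B = (#T : ℚ) • symmetrizer B := by
  rw [jucysMurphy, sum_mul, sum_congr rfl fun i hi => swap_mul_symmetrizer (hT hi) htB]
  simp [← Nat.cast_smul_eq_nsmul ℚ]

theorem commute_antisymmetrizer_of_forall {B : Finset α} {z : MonoidAlgebra ℚ (Perm α)}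
    (h : ∀ σ ∈ permsOn B, Commute z (permElt σ)) : Commute z (antisymmetrizer B) :=
  Commute.sum_right _ _ _ fun σ hσ => (h σ hσ).smul_right _

theorem commute_jucysMurphy_antisymmetrizer {B : Finset α} {t : α} (ht : t ∉ B) :
    Commute (jucysMurphy B t) (antisymmetrizer B) := by
  refine commute_antisymmetrizer_of_forall fun σ hσ => ?_
  have hst := mem_permsOn.1 hσ t ht
  rw [Commute, SemiconjBy, jucysMurphy, sum_mul, mul_sum]
  refine (sum_nbij' (σ ·) (σ⁻¹ ·) ?_ ?_ ?_ ?_ ?_).symm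
  · exact fun i hi => (apply_mem_of_mem_permsOn hσ).2 hi
  · exact fun i hi => (apply_mem_of_mem_permsOn hσ).1 (by simpa using hi)
  · simp
  · simp
  · intro i _
    rw [← map_mul, ← map_mul, mul_swap_eq_swap_mul, hst]

theorem commute_jucysMurphy_antisymmetrizer_of_disjoint {B T : Finset α} {t : α} (ht : t ∉ B)
    (hT : Disjoint T B) : Commute (jucysMurphy T t) (antisymmetrizer B) := by
  refine commute_antisymmetrizer_of_forall fun σ hσ => Commute.sum_left _ _ _ fun i hi => ?_
  have hst := mem_permsOn.1 hσ t ht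
  have hsi := mem_permsOn.1 hσ i (disjoint_left.1 hT hi)
  rw [Commute, SemiconjBy, ← map_mul, ← map_mul, mul_swap_eq_swap_mul, hst, hsi]

theorem antisymmetrizer_mul_symmetrizer_eq_zero {B C : Finset α} {i j : α} (hiB : i ∈ B)
    (hjB : j ∈ B) (hiC : i ∈ C) (hjC : j ∈ C) (hij : i ≠ j) :
    antisymmetrizer B * symmetrizer C = 0 := by
  have h : antisymmetrizer B * symmetrizer C = -(antisymmetrizer B * symmetrizer C) := by
    conv_lhs => rw [← swap_mul_symmetrizer hiC hjC, ← mul_assoc,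
      antisymmetrizer_mul_swap hiB hjB hij, neg_mul]
  rw [eq_neg_iff_add_eq_zero, ← two_smul ℚ] at h
  exact (smul_eq_zero.1 h).resolve_left two_ne_zero

theorem jucysMurphy_mul_hook {B C T : Finset α} {o t : α} (hoB : o ∈ B) (hoC : o ∈ C)
    (htB : t ∉ B) (htC : t ∈ C) (hTC : T ⊆ C) (hTB : Disjoint T B) :
    jucysMurphy (B ∪ T) t * (antisymmetrizer B * symmetrizer C) =
      (#T + 1 : ℚ) • (antisymmetrizer B * symmetrizer C) := by
  have hsplit : jucysMurphy (B ∪ T) t = jucysMurphy B t + jucysMurphy T t :=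
    sum_union hTB.symm
  have h0 : antisymmetrizer B * jucysMurphy B t * symmetrizer C =
      antisymmetrizer B * symmetrizer C := by
    have h := antisymmetrizer_mul_symmetrizer_eq_zero (mem_insert_of_mem hoB)
      (mem_insert_self t B) hoC htC fun h => htB (h ▸ hoB)
    rw [antisymmetrizer_insert htB, mul_sub, mul_one, sub_mul, sub_eq_zero] at h
    exact h.symm
  rw [hsplit, add_mul, ← mul_assoc, ← mul_assoc,
    (commute_jucysMurphy_antisymmetrizer htB).eq, h0,
    (commute_jucysMurphy_antisymmetrizer_of_disjoint htB hTB).eq, mul_assoc,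
    jucysMurphy_mul_symmetrizer hTC htC, mul_smul_comm, add_smul, one_smul, add_comm]

/-- The weighted sum `∑ u σ σ` over the permutations supported in `T`. -/
noncomputable def weightedSum (u : Perm α → ℚ) (T : Finset α) : MonoidAlgebra ℚ (Perm α) :=
  ∑ σ ∈ permsOn T, u σ • permElt σ

theorem weightedSum_insert {u : Perm α → ℚ} {x : ℚ}
    (hu : ∀ (τ : Perm α) (i t : α), τ t = t → i ≠ t → u (τ * swap i t) = x⁻¹ * u τ)
    {T : Finset α} {t : α} (ht : t ∉ T) :
    weightedSum u (insert t T) = weightedSum u T * (1 + x⁻¹ • jucysMurphy T t) := by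
  rw [weightedSum, sum_permsOn_insert ht, mul_add, mul_one, jucysMurphy, smul_sum, mul_sum]
  congr 1
  refine sum_congr rfl fun i hi => ?_
  rw [weightedSum, sum_mul]
  refine sum_congr rfl fun σ hσ => ?_
  rw [hu σ i t (mem_permsOn.1 hσ t ht) fun h => ht (h ▸ hi), permElt, map_mul,
    smul_mul_smul_comm, mul_comm]

theorem weightedSum_insert_mul {u : Perm α → ℚ} {x c s : ℚ}
    (hu : ∀ (τ : Perm α) (i t : α), τ t = t → i ≠ t → u (τ * swap i t) = x⁻¹ * u τ)
    {T : Finset α} {t : α} (ht : t ∉ T) {v : MonoidAlgebra ℚ (Perm α)}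
    (hv : jucysMurphy T t * v = c • v) (hT : weightedSum u T * v = s • v) :
    weightedSum u (insert t T) * v = (s * (1 + x⁻¹ * c)) • v := by
  rw [weightedSum_insert hu ht, mul_assoc, add_mul, one_mul, smul_mul_assoc, hv, mul_add, hT,
    mul_smul_comm, mul_smul_comm, hT, smul_smul, smul_smul, ← add_smul]
  congr 1
  ring

theorem weightedSum_mul_hook {u : Perm α → ℚ} {x : ℚ} (hx : x ≠ 0)
    (hu : ∀ (τ : Perm α) (i t : α), τ t = t → i ≠ t → u (τ * swap i t) = x⁻¹ * u τ)
    (hu1 : u 1 = x ^ Fintype.card α) {B : Finset α} {o : α} (ho : o ∉ B) :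
    weightedSum u univ * (antisymmetrizer (insert o B) * symmetrizer Bᶜ) =
      (∏ j ∈ range (Fintype.card α), (x - #B + j)) •
        (antisymmetrizer (insert o B) * symmetrizer Bᶜ) := by
  set v := antisymmetrizer (insert o B) * symmetrizer Bᶜ with hv
  have h1 : ∀ T, T ⊆ insert o B →
      weightedSum u T * v = (x ^ Fintype.card α * ∏ j ∈ range #T, (1 + x⁻¹ * -(j : ℚ))) • v := by
    intro T
    induction T using Finset.induction_on with
    | empty => intro _; simp [weightedSum, permsOn_empty, hu1, permElt, -MonoidAlgebra.of_apply]
    | insert t T ht ih =>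
      intro h
      rw [insert_subset_iff] at h
      rw [weightedSum_insert_mul hu ht (c := -(#T : ℚ)) ?_ (ih h.2), card_insert_of_notMem ht,
        prod_range_succ, mul_assoc]
      rw [hv, ← mul_assoc, jucysMurphy_mul_antisymmetrizer h.2 h.1 ht, smul_mul_assoc]
  have h2 : ∀ T, T ⊆ (insert o B)ᶜ → weightedSum u (insert o B ∪ T) * v =
      (x ^ Fintype.card α * (∏ j ∈ range #(insert o B), (1 + x⁻¹ * -(j : ℚ))) *
        ∏ j ∈ range #T, (1 + x⁻¹ * (j + 1))) • v := by
    intro T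
    induction T using Finset.induction_on with
    | empty => intro _; simpa using h1 _ subset_rfl
    | insert t T ht ih =>
      intro h
      rw [insert_subset_iff] at h
      have htB := mem_compl.1 h.1
      have htn : t ∉ insert o B ∪ T := by simp only [mem_union, not_or]; exact ⟨htB, ht⟩
      rw [union_insert, weightedSum_insert_mul hu htn (c := (#T + 1 : ℚ)) ?_ (ih h.2),
        card_insert_of_notMem ht, prod_range_succ, mul_assoc]
      refine jucysMurphy_mul_hook (mem_insert_self o B) (mem_compl.2 ho) htB ?_ ?_ ?_
      · exact mem_compl.2 fun h => htB (mem_insert_of_mem h)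
      · exact h.2.trans (compl_subset_compl.2 (subset_insert _ _))
      · exact (subset_compl_iff_disjoint_right.1 h.2)
  have h3 := h2 _ subset_rfl
  rw [union_compl] at h3
  rw [h3]
  congr 1
  have hc : Fintype.card α = #B + 1 + #(insert o B)ᶜ := by
    rw [← card_insert_of_notMem ho, card_add_card_compl]
  rw [card_insert_of_notMem ho]
  set q := #(insert o B)ᶜ
  have e1 : x ^ (#B + 1) * ∏ j ∈ range (#B + 1), (1 + x⁻¹ * -(j : ℚ)) =
      ∏ j ∈ range (#B + 1), (x - #B + j) := by
    rw [← prod_range_reflect (fun j : ℕ => x - #B + j), pow_mul_prod_range]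
    refine prod_congr rfl fun j hj => ?_
    rw [mem_range, Nat.lt_succ_iff] at hj
    rw [Nat.add_sub_cancel, Nat.cast_sub hj]
    field_simp
    ring
  have e2 : x ^ q * ∏ j ∈ range q, (1 + x⁻¹ * (j + 1)) =
      ∏ j ∈ range q, (x - #B + (#B + 1 + j : ℕ)) := by
    rw [pow_mul_prod_range]
    refine prod_congr rfl fun j _ => ?_
    push_cast
    field_simp
    ring
  rw [hc, prod_range_add (fun j : ℕ => x - #B + j), ← e1, ← e2, pow_add]
  ring

/-- The class function `π ↦ ∑ u σ₁ u σ₂` over the pairs with `σ₁ σ₂ = π⁻¹`. -/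
def pairWeight (u : Perm α → ℚ) (π : Perm α) : ℚ :=
  ∑ σ₁, ∑ σ₂, if σ₁ * σ₂ * π = 1 then u σ₁ * u σ₂ else 0

theorem coeff_permElt_one (σ : Perm α) : (permElt σ).coeff 1 = if σ = 1 then 1 else 0 := by
  simp [permElt, Finsupp.single_apply]

theorem pairWeight_eq_coeff (u : Perm α → ℚ) (π : Perm α) :
    pairWeight u π =
      (weightedSum u univ * (weightedSum u univ * permElt π)).coeff 1 := by
  rw [← mul_assoc, weightedSum, permsOn_univ, sum_mul_sum, sum_mul, pairWeight,
    MonoidAlgebra.coeff_sum, Finsupp.finsetSum_apply]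
  refine sum_congr rfl fun σ₁ _ => ?_
  rw [sum_mul, MonoidAlgebra.coeff_sum, Finsupp.finsetSum_apply]
  refine sum_congr rfl fun σ₂ _ => ?_
  rw [smul_mul_smul_comm, smul_mul_assoc, ← map_mul, ← map_mul, MonoidAlgebra.coeff_smul,
    Finsupp.smul_apply, coeff_permElt_one, smul_eq_mul, mul_ite, mul_one, mul_zero]

theorem pairWeight_conj {u : Perm α → ℚ} (hu : ∀ σ τ, u (τ * σ * τ⁻¹) = u σ) (π τ : Perm α) :
    pairWeight u (τ * π * τ⁻¹) = pairWeight u π := by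
  symm
  refine Fintype.sum_equiv (MulAut.conj τ).toEquiv _ _ fun σ₁ => ?_
  refine Fintype.sum_equiv (MulAut.conj τ).toEquiv _ _ fun σ₂ => ?_
  simp only [MulEquiv.toEquiv_eq_coe, MulEquiv.coe_toEquiv, MulAut.conj_apply, hu]
  congr 1
  rw [show τ * σ₁ * τ⁻¹ * (τ * σ₂ * τ⁻¹) * (τ * π * τ⁻¹) = τ * (σ₁ * σ₂ * π) * τ⁻¹ by group,
    conj_eq_one_iff]

theorem hook_eq_sum (B C : Finset α) :
    antisymmetrizer B * symmetrizer C = ∑ p ∈ permsOn B, ∑ q ∈ permsOn C,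
      ((Perm.sign p : ℤ) : ℚ) • permElt (p * q) := by
  rw [antisymmetrizer, symmetrizer, sum_mul_sum]
  refine sum_congr rfl fun p _ => sum_congr rfl fun q _ => ?_
  rw [smul_mul_assoc, ← map_mul]

theorem sum_sign_mul_eq_coeff (z : MonoidAlgebra ℚ (Perm α)) (B C : Finset α) :
    ∑ p ∈ permsOn B, ∑ q ∈ permsOn C,
      ((Perm.sign p : ℤ) : ℚ) * (z * permElt (p * q)).coeff 1 =
      (z * (antisymmetrizer B * symmetrizer C)).coeff 1 := by
  rw [hook_eq_sum, mul_sum, MonoidAlgebra.coeff_sum, Finsupp.finsetSum_apply]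
  refine sum_congr rfl fun p _ => ?_
  rw [mul_sum, MonoidAlgebra.coeff_sum, Finsupp.finsetSum_apply]
  refine sum_congr rfl fun q _ => ?_
  rw [mul_smul_comm, MonoidAlgebra.coeff_smul, Finsupp.smul_apply, smul_eq_mul]

theorem hook_coeff_one {B : Finset α} {o : α} :
    (antisymmetrizer (insert o B) * symmetrizer Bᶜ).coeff 1 = 1 := by
  rw [← one_mul (_ * _), ← sum_sign_mul_eq_coeff]
  simp only [one_mul, coeff_permElt_one]
  have h1 : ∀ T : Finset α, 1 ∈ permsOn T := fun T => mem_permsOn.2 fun x _ => rfl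
  have key : ∀ p ∈ permsOn (insert o B), ∀ q ∈ permsOn Bᶜ, p * q = 1 → p = 1 := by
    intro p hp q hq h
    have hpx : ∀ x, x ≠ o → p x = x := by
      intro x hx
      by_cases hxB : x ∈ B
      · have hqx : q x = x := mem_permsOn.1 hq x (by simpa using hxB)
        calc p x = p (q x) := by rw [hqx]
          _ = x := by rw [← Perm.mul_apply, h, Perm.one_apply]
      · exact mem_permsOn.1 hp x (by simp [hx, hxB])
    ext x
    rcases eq_or_ne x o with rfl | hx
    · by_contra hne
      exact hne (p.injective (hpx _ hne))
    · exact hpx x hx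
  rw [sum_eq_single_of_mem 1 (h1 _), sum_eq_single_of_mem 1 (h1 _)]
  · simp
  · intro q _ hq
    simp [hq]
  · intro p hp hne
    refine sum_eq_zero fun q hq => ?_
    rw [if_neg fun h => hne (key p hp q hq h), mul_zero]

theorem sum_sign_mul_pairWeight {u : Perm α → ℚ} {x : ℚ} (hx : x ≠ 0)
    (hu : ∀ (τ : Perm α) (i t : α), τ t = t → i ≠ t → u (τ * swap i t) = x⁻¹ * u τ)
    (hu1 : u 1 = x ^ Fintype.card α) {B : Finset α} {o : α} (ho : o ∉ B) :
    ∑ p ∈ permsOn (insert o B), ∑ q ∈ permsOn Bᶜ,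
      ((Perm.sign p : ℤ) : ℚ) * pairWeight u (p * q) =
        (∏ j ∈ range (Fintype.card α), (x - #B + j)) ^ 2 := by
  simp only [pairWeight_eq_coeff, ← mul_assoc]
  simp only [sum_sign_mul_eq_coeff]
  rw [mul_assoc, weightedSum_mul_hook hx hu hu1 ho, mul_smul_comm,
    weightedSum_mul_hook hx hu hu1 ho, smul_smul, MonoidAlgebra.coeff_smul, Finsupp.smul_apply,
    hook_coeff_one, smul_eq_mul, mul_one, sq]

end HookIdempotent

section SplitPairs
variable {α : Type*} [Fintype α] [DecidableEq α]

/-- The triples `(B, p, q)` with `o ∉ B`, `p` supported in `B ∪ {o}` and `q` supported in the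
complement of `B`. -/
def splitTriples (o : α) : Finset (Finset α × Perm α × Perm α) :=
  univ.filter fun t => o ∉ t.1 ∧ (∀ x, x ≠ o → x ∉ t.1 → t.2.1 x = x) ∧ ∀ x ∈ t.1, t.2.2 x = x

theorem mem_splitTriples {o : α} {B : Finset α} {p q : Perm α} :
    (B, p, q) ∈ splitTriples o ↔
      o ∉ B ∧ (∀ x, x ≠ o → x ∉ B → p x = x) ∧ ∀ x ∈ B, q x = x := by
  simp [splitTriples]

/-- The signed weight of a triple. -/
def splitSign (t : Finset α × Perm α × Perm α) : ℚ :=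
  (-1) ^ #t.1 * ((Perm.sign t.2.1 : ℤ) : ℚ)

theorem sum_splitTriples (o : α) (F : Perm α → ℚ) :
    ∑ t ∈ splitTriples o, splitSign t * F (t.2.1 * t.2.2) =
      ∑ B ∈ (univ.erase o).powerset, (-1) ^ #B * ∑ p ∈ permsOn (insert o B), ∑ q ∈ permsOn Bᶜ,
        ((Perm.sign p : ℤ) : ℚ) * F (p * q) := by
  have h : splitTriples o = (univ.erase o).powerset.biUnion
      fun B => (({B} : Finset (Finset α)) ×ˢ (permsOn (insert o B) ×ˢ permsOn Bᶜ)) := by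
    ext ⟨B, p, q⟩
    simp only [mem_splitTriples, mem_biUnion, mem_powerset, mem_product, mem_singleton,
      mem_permsOn, mem_insert, not_or, and_imp, mem_compl, not_not, subset_erase, subset_univ,
      true_and]
    constructor
    · rintro ⟨h1, h2, h3⟩
      exact ⟨B, h1, rfl, h2, h3⟩
    · rintro ⟨_, h1, rfl, h2, h3⟩
      exact ⟨h1, h2, h3⟩
  rw [h, sum_biUnion]
  · refine sum_congr rfl fun B _ => ?_
    rw [sum_product, sum_singleton, sum_product, mul_sum]
    refine sum_congr rfl fun p _ => ?_
    rw [mul_sum]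
    exact sum_congr rfl fun q _ => by rw [splitSign, mul_assoc]
  · intro B _ B' _ hne
    rw [Function.onFun, disjoint_left]
    rintro ⟨C, p, q⟩ h1 h2
    simp only [mem_product, mem_singleton] at h1 h2
    exact hne (h1.1.symm.trans h2.1)

/-- The orbit of `z` under `π`. -/
noncomputable def orbitFinset (π : Perm α) (z : α) : Finset α := by
  classical exact univ.filter (π.SameCycle z)

theorem mem_orbitFinset {π : Perm α} {z y : α} : y ∈ orbitFinset π z ↔ π.SameCycle z y := by
  simp [orbitFinset]

/-- `π` restricted to the orbit of `z`. -/
noncomputable def orbitPerm (π : Perm α) (z : α) : Perm α := by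
  classical exact π.cycleOf z

theorem orbitPerm_apply_of_mem {π : Perm α} {z y : α} (h : y ∈ orbitFinset π z) :
    orbitPerm π z y = π y :=
  Perm.SameCycle.cycleOf_apply (mem_orbitFinset.1 h)

theorem orbitPerm_apply_of_notMem {π : Perm α} {z y : α} (h : y ∉ orbitFinset π z) :
    orbitPerm π z y = y :=
  Perm.cycleOf_apply_of_not_sameCycle (mt mem_orbitFinset.2 h)

theorem apply_mem_orbitFinset {π : Perm α} {z y : α} :
    π y ∈ orbitFinset π z ↔ y ∈ orbitFinset π z := by
  rw [mem_orbitFinset, mem_orbitFinset, Perm.sameCycle_apply_right]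

theorem orbitPerm_inv_apply_of_mem {π : Perm α} {z y : α} (h : π y ∈ orbitFinset π z) :
    (orbitPerm π z)⁻¹ (π y) = y := by
  rw [Perm.inv_eq_iff_eq, orbitPerm_apply_of_mem (apply_mem_orbitFinset.1 h)]

theorem orbitPerm_inv_apply_of_notMem {π : Perm α} {z y : α} (h : y ∉ orbitFinset π z) :
    (orbitPerm π z)⁻¹ y = y := by
  rw [Perm.inv_eq_iff_eq, orbitPerm_apply_of_notMem h]

theorem sign_orbitPerm (π : Perm α) (z : α) :
    ((Perm.sign (orbitPerm π z) : ℤ) : ℚ) = -(-1) ^ #(orbitFinset π z) := by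
  classical
  by_cases hz : π z = z
  · have h1 : orbitPerm π z = 1 := by
      rw [orbitPerm, Perm.cycleOf_eq_one_iff]; exact hz
    have h2 : orbitFinset π z = {z} := by
      ext y
      rw [mem_orbitFinset, mem_singleton]
      exact ⟨fun h => (h.eq_of_left hz).symm, fun h => h ▸ Perm.SameCycle.refl _ _⟩
    rw [h1, h2]; simp
  · have h2 : orbitFinset π z = (π.cycleOf z).support := by
      ext y
      rw [mem_orbitFinset, Perm.mem_support_cycleOf_iff]
      exact ⟨fun h => ⟨h, Perm.mem_support.2 hz⟩, fun h => h.1⟩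
    have h3 : Perm.sign (orbitPerm π z) = -(-1) ^ #(orbitFinset π z) := by
      rw [h2]; exact (Perm.isCycle_cycleOf π hz).sign
    rw [h3]; simp

theorem orbit_subset_of_mem {o z : α} {B : Finset α} {p q : Perm α}
    (h : (B, p, q) ∈ splitTriples o) (ho : ¬ (p * q).SameCycle o z) (hz : z ∈ B) :
    ∀ y ∈ orbitFinset (p * q) z, y ∈ B ∧ p y = (p * q) y := by
  obtain ⟨hoB, hp, hq⟩ := mem_splitTriples.1 h
  have hpB : ∀ y ∈ B, p y = o ∨ p y ∈ B := by
    intro y hy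
    by_contra! hc
    exact hc.2 ((p.injective (hp _ hc.1 hc.2)).symm ▸ hy)
  have hstep : ∀ y ∈ B, p y = (p * q) y := fun y hy => by rw [Perm.mul_apply, hq y hy]
  have hmem : ∀ y, (p * q).SameCycle z y → y ∈ B := by
    intro y hy
    obtain ⟨i, -, rfl⟩ := hy.exists_pow_eq'
    clear hy
    induction i with
    | zero => exact hz
    | succ i ih =>
      rw [pow_succ', Perm.mul_apply, ← hstep _ ih]
      refine (hpB _ ih).resolve_left fun h => ho ?_
      rw [← h, hstep _ ih, Perm.sameCycle_apply_left]
      exact Perm.SameCycle.symm ⟨i, by simp⟩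
  intro y hy
  have := hmem y (mem_orbitFinset.1 hy)
  exact ⟨this, hstep y this⟩

theorem orbit_disjoint_of_notMem {o z : α} {B : Finset α} {p q : Perm α}
    (h : (B, p, q) ∈ splitTriples o) (ho : ¬ (p * q).SameCycle o z) (hz : z ∉ B) :
    ∀ y ∈ orbitFinset (p * q) z, y ∉ B ∧ p y = y ∧ q y = (p * q) y := by
  obtain ⟨hoB, hp, hq⟩ := mem_splitTriples.1 h
  have hne : ∀ y, (p * q).SameCycle z y → y ≠ o := fun y hy hyo => ho (hyo ▸ hy).symm
  have hmem : ∀ y, (p * q).SameCycle z y → y ∉ B := by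
    intro y hy
    obtain ⟨i, -, rfl⟩ := (Perm.sameCycle_inv.2 hy).exists_pow_eq'
    clear hy
    induction i with
    | zero => exact hz
    | succ i ih =>
      set w := ((p * q)⁻¹ ^ i) z with hw
      have hzw : (p * q).SameCycle z w := ⟨-i, by rw [hw, zpow_neg, zpow_natCast, inv_pow]⟩
      have hpw : p w = w := hp w (hne w hzw) ih
      rw [pow_succ', Perm.mul_apply, ← hw]
      intro hB
      have h2 : p ((p * q)⁻¹ w) = p w := by
        conv_lhs => rw [← hq _ hB]
        rw [← Perm.mul_apply, hpw]
        simp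
      exact ih (p.injective h2 ▸ hB)
  intro y hy
  rw [mem_orbitFinset] at hy
  refine ⟨hmem y hy, hp y (hne y hy) (hmem y hy), ?_⟩
  have hy' := Perm.sameCycle_apply_right.2 hy
  exact (p.injective (hp _ (hne _ hy') (hmem _ hy'))).symm

open Classical in
/-- Moving the orbit of `z` between the two factors of a triple. -/
noncomputable def toggleOrbit (z : α) (t : Finset α × Perm α × Perm α) :
    Finset α × Perm α × Perm α :=
  let C := orbitFinset (t.2.1 * t.2.2) z
  let c := orbitPerm (t.2.1 * t.2.2) z
  if z ∈ t.1 then (t.1 \ C, t.2.1 * c⁻¹, c * t.2.2) else (t.1 ∪ C, t.2.1 * c, c⁻¹ * t.2.2)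

theorem toggleOrbit_prod (z : α) (t : Finset α × Perm α × Perm α) :
    (toggleOrbit z t).2.1 * (toggleOrbit z t).2.2 = t.2.1 * t.2.2 := by
  by_cases hz : z ∈ t.1 <;> simp [toggleOrbit, hz, mul_assoc]

theorem self_mem_orbitFinset (π : Perm α) (z : α) : z ∈ orbitFinset π z :=
  mem_orbitFinset.2 (Perm.SameCycle.refl _ _)

theorem mem_toggleOrbit_fst (z : α) (t : Finset α × Perm α × Perm α) :
    z ∈ (toggleOrbit z t).1 ↔ z ∉ t.1 := by
  by_cases hz : z ∈ t.1 <;> simp [toggleOrbit, hz, self_mem_orbitFinset]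

theorem toggleOrbit_mem {o z : α} {t : Finset α × Perm α × Perm α} (h : t ∈ splitTriples o)
    (ho : ¬ (t.2.1 * t.2.2).SameCycle o z) : toggleOrbit z t ∈ splitTriples o := by
  obtain ⟨B, p, q⟩ := t
  obtain ⟨hoB, hp, hq⟩ := mem_splitTriples.1 h
  dsimp only at ho
  by_cases hz : z ∈ B
  · have key := orbit_subset_of_mem h ho hz
    simp only [toggleOrbit, hz, if_true]
    refine mem_splitTriples.2 ⟨fun h => hoB (mem_sdiff.1 h).1, fun y hyo hy => ?_, fun y hy => ?_⟩
    · rw [mem_sdiff, not_and, not_not] at hy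
      by_cases hyC : y ∈ orbitFinset (p * q) z
      · obtain ⟨w, rfl⟩ := (p * q).surjective y
        rw [Perm.mul_apply p _, orbitPerm_inv_apply_of_mem hyC]
        exact (key w (apply_mem_orbitFinset.1 hyC)).2
      · rw [Perm.mul_apply p _, orbitPerm_inv_apply_of_notMem hyC]
        exact hp y hyo fun h => hyC (hy h)
    · rw [mem_sdiff] at hy
      rw [Perm.mul_apply _ q, hq y hy.1, orbitPerm_apply_of_notMem hy.2]
  · have key := orbit_disjoint_of_notMem h ho hz
    simp only [toggleOrbit, hz, if_false]
    refine mem_splitTriples.2 ⟨fun h => ?_, fun y hyo hy => ?_, fun y hy => ?_⟩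
    · exact (mem_union.1 h).elim hoB fun h => ho (mem_orbitFinset.1 h).symm
    · rw [mem_union, not_or] at hy
      rw [Perm.mul_apply p _, orbitPerm_apply_of_notMem hy.2, hp y hyo hy.1]
    · rw [Perm.mul_apply _ q]
      by_cases hyC : y ∈ orbitFinset (p * q) z
      · rw [(key y hyC).2.2, orbitPerm_inv_apply_of_mem (apply_mem_orbitFinset.2 hyC)]
      · rw [hq y ((mem_union.1 hy).resolve_right hyC), orbitPerm_inv_apply_of_notMem hyC]

theorem toggleOrbit_toggleOrbit {o z : α} {t : Finset α × Perm α × Perm α}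
    (h : t ∈ splitTriples o) (ho : ¬ (t.2.1 * t.2.2).SameCycle o z) :
    toggleOrbit z (toggleOrbit z t) = t := by
  have hz' := mem_toggleOrbit_fst z t
  have hprod := toggleOrbit_prod z t
  rw [toggleOrbit, hprod]
  obtain ⟨B, p, q⟩ := t
  by_cases hz : z ∈ B
  · have hsub : orbitFinset (p * q) z ⊆ B := fun y hy => (orbit_subset_of_mem h ho hz y hy).1
    simp only [hz', hz, not_true_eq_false, if_false]
    simp [toggleOrbit, hz, sdiff_union_of_subset hsub]
  · have hdis : Disjoint B (orbitFinset (p * q) z) :=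
      disjoint_right.2 fun y hy => (orbit_disjoint_of_notMem h ho hz y hy).1
    simp only [hz', hz, not_false_eq_true, if_true]
    simp [toggleOrbit, hz, union_sdiff_cancel_right hdis]

theorem splitSign_toggleOrbit {o z : α} {t : Finset α × Perm α × Perm α}
    (h : t ∈ splitTriples o) (ho : ¬ (t.2.1 * t.2.2).SameCycle o z) :
    splitSign (toggleOrbit z t) = -splitSign t := by
  obtain ⟨B, p, q⟩ := t
  have hs := sign_orbitPerm (p * q) z
  have hsq : ((-1 : ℚ) ^ #(orbitFinset (p * q) z)) * (-1) ^ #(orbitFinset (p * q) z) = 1 := by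
    rw [← mul_pow]; norm_num
  by_cases hz : z ∈ B
  · have hsub : orbitFinset (p * q) z ⊆ B := fun y hy => (orbit_subset_of_mem h ho hz y hy).1
    have hc : #B = #(B \ orbitFinset (p * q) z) + #(orbitFinset (p * q) z) := by
      rw [card_sdiff_add_card_eq_card hsub]
    simp only [toggleOrbit, hz, if_true, splitSign, Perm.sign_mul, Perm.sign_inv, Units.val_mul,
      Int.cast_mul, hs]
    rw [hc, pow_add]
    ring
  · have hdis : Disjoint B (orbitFinset (p * q) z) :=
      disjoint_right.2 fun y hy => (orbit_disjoint_of_notMem h ho hz y hy).1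
    simp only [toggleOrbit, hz, if_false, splitSign, Perm.sign_mul, Units.val_mul, Int.cast_mul,
      hs, card_union_of_disjoint hdis]
    rw [pow_add]
    linear_combination (-(-1) ^ #B * ((Perm.sign p : ℤ) : ℚ)) * hsq

open Classical in
theorem sum_splitTriples_not_transitive (o : α) (F : Perm α → ℚ) :
    ∑ t ∈ splitTriples o with ¬ ∀ z, (t.2.1 * t.2.2).SameCycle o z,
      splitSign t * F (t.2.1 * t.2.2) = 0 := by
  have hex : ∀ π : Perm α, ∃ z, (¬ ∀ z, π.SameCycle o z) → ¬ π.SameCycle o z := by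
    intro π
    by_cases h : ∀ z, π.SameCycle o z
    · exact ⟨o, fun h2 => absurd h h2⟩
    · obtain ⟨z, hz⟩ := not_forall.1 h
      exact ⟨z, fun _ => hz⟩
  choose Z hZ using hex
  refine sum_involution (fun t _ => toggleOrbit (Z (t.2.1 * t.2.2)) t) ?_ ?_ ?_ ?_
  · intro t ht
    rw [mem_filter] at ht
    rw [splitSign_toggleOrbit ht.1 (hZ _ ht.2), toggleOrbit_prod]
    ring
  · intro t ht _ h
    have := mem_toggleOrbit_fst (Z (t.2.1 * t.2.2)) t
    rw [h] at this
    exact iff_not_self this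
  · intro t ht
    rw [mem_filter] at ht ⊢
    rw [toggleOrbit_prod]
    exact ⟨toggleOrbit_mem ht.1 (hZ _ ht.2), ht.2⟩
  · intro t ht
    rw [mem_filter] at ht
    rw [toggleOrbit_prod]
    exact toggleOrbit_toggleOrbit ht.1 (hZ _ ht.2)

theorem isConj_of_transitive {o : α} {π ρ : Perm α} (hπ : ∀ z, π.SameCycle o z)
    (hρ : ∀ z, ρ.SameCycle o z) : IsConj π ρ := by
  rcases subsingleton_or_nontrivial α with h | h
  · rw [Subsingleton.elim π ρ]
  have key : ∀ σ : Perm α, (∀ z, σ.SameCycle o z) → σ.IsCycle ∧ #σ.support = Fintype.card α := by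
    intro σ hσ
    have hne : ∀ x, σ x ≠ x := by
      intro x hx
      obtain ⟨y, hy⟩ := exists_ne x
      exact hy (((hσ x).symm.trans (hσ y)).eq_of_left hx).symm
    refine ⟨⟨o, hne o, fun y _ => hσ y⟩, ?_⟩
    rw [← card_univ]
    congr 1
    exact eq_univ_of_forall fun x => Perm.mem_support.2 (hne x)
  exact (key π hπ).1.isConj (key ρ hρ).1 ((key π hπ).2.trans (key ρ hρ).2.symm)

open Classical in
theorem sum_splitTriples_eq_mul {o : α} {F : Perm α → ℚ} (hF : ∀ π τ, F (τ * π * τ⁻¹) = F π)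
    {ρ : Perm α} (hρ : ∀ z, ρ.SameCycle o z) :
    ∑ t ∈ splitTriples o, splitSign t * F (t.2.1 * t.2.2) =
      (∑ t ∈ splitTriples o with ∀ z, (t.2.1 * t.2.2).SameCycle o z, splitSign t) * F ρ := by
  rw [← sum_filter_add_sum_filter_not (splitTriples o)
    (fun t => ∀ z, (t.2.1 * t.2.2).SameCycle o z), sum_splitTriples_not_transitive, add_zero,
    sum_mul]
  refine sum_congr rfl fun t ht => ?_
  obtain ⟨τ, hτ⟩ := isConj_iff.1 (isConj_of_transitive (mem_filter.1 ht).2 hρ)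
  rw [← hτ, hF]

theorem sum_sign_permsOn {T : Finset α} {i j : α} (hi : i ∈ T) (hj : j ∈ T) (hij : i ≠ j) :
    ∑ p ∈ permsOn T, ((Perm.sign p : ℤ) : ℚ) = 0 := by
  have h := sum_permsOn_mul_swap hi hj fun p => ((Perm.sign p : ℤ) : ℚ)
  simp only [Perm.sign_mul, Perm.sign_swap hij, mul_neg, mul_one, Units.val_neg, Int.cast_neg,
    sum_neg_distrib] at h
  linarith

theorem sum_signed_powerset (o : α) {F : Perm α → ℚ} (hF : ∀ π τ, F (τ * π * τ⁻¹) = F π)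
    {ρ : Perm α} (hρ : ∀ z, ρ.SameCycle o z) :
    ∑ B ∈ (univ.erase o).powerset, (-1) ^ #B * ∑ p ∈ permsOn (insert o B), ∑ q ∈ permsOn Bᶜ,
        ((Perm.sign p : ℤ) : ℚ) * F (p * q) = (Fintype.card α).factorial * F ρ := by
  classical
  have h1 := sum_splitTriples_eq_mul (F := fun _ => 1) (fun _ _ => rfl) hρ
  rw [sum_splitTriples o (fun _ => 1), mul_one, sum_eq_single_of_mem ∅ (empty_mem_powerset _)] at h1
  · have he : permsOn (insert o (∅ : Finset α)) = {1} := by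
      ext σ
      rw [mem_permsOn, mem_singleton]
      refine ⟨fun h => ?_, fun h => by simp [h]⟩
      ext x
      have hx : ∀ x, x ≠ o → σ x = x := fun x hx => h x (by simpa using hx)
      rcases eq_or_ne x o with rfl | hxo
      · by_contra hne
        exact hne (σ.injective (hx _ hne))
      · exact hx x hxo
    rw [← sum_splitTriples, sum_splitTriples_eq_mul hF hρ, ← h1, he, compl_empty, permsOn_univ]
    simp [Fintype.card_perm]
  · intro B hB hne
    obtain ⟨b, hb⟩ := nonempty_iff_ne_empty.2 hne
    have hbo : o ≠ b := fun h => notMem_erase o univ (mem_powerset.1 hB (h ▸ hb))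
    simp only [mul_one, sum_const, ← smul_sum]
    rw [sum_sign_permsOn (mem_insert_self o B) (mem_insert_of_mem hb) hbo]
    simp

end SplitPairs

section OneFace
open Polynomial

theorem cycleCount_one (n : ℕ) : cycleCount (1 : Perm (Fin n)) = n := by
  simp [cycleCount]

theorem cycleCount_conj {n : ℕ} (σ τ : Perm (Fin n)) :
    cycleCount (τ * σ * τ⁻¹) = cycleCount σ := by
  rw [cycleCount, Perm.cycleType_conj, cycleCount]

theorem sameCycle_finRotate {m : ℕ} (z : Fin (m + 1)) :
    (finRotate (m + 1)).SameCycle 0 z := by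
  rcases m with _ | m
  · obtain rfl : z = 0 := Fin.ext (by omega)
    rfl
  · have h : ∀ x : Fin (m + 2), finRotate (m + 2) x ≠ x := fun x => by
      rw [← Perm.mem_support, support_finRotate]; exact mem_univ x
    exact isCycle_finRotate.sameCycle (h 0) (h z)

/-- The generating polynomial of the factorizations of the standard cycle by number of cycles. -/
noncomputable def oneFacePoly (n : ℕ) : ℚ[X] :=
  ∑ p : Perm (Fin n) × Perm (Fin n) with p.1 * p.2 = finRotate n,
    X ^ (cycleCount p.1 + cycleCount p.2)

theorem eval_oneFacePoly (n : ℕ) (x : ℚ) :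
    (oneFacePoly n).eval x =
      pairWeight (fun σ : Perm (Fin n) => x ^ cycleCount σ) (finRotate n)⁻¹ := by
  rw [oneFacePoly, eval_finsetSum, sum_filter, Fintype.sum_prod_type, pairWeight]
  refine sum_congr rfl fun σ₁ _ => sum_congr rfl fun σ₂ _ => ?_
  simp only [mul_inv_eq_one, eval_mul, eval_pow, eval_X, pow_add]

theorem factorial_mul_eval_oneFacePoly (m : ℕ) {x : ℚ} (hx : x ≠ 0) :
    ((m + 1).factorial : ℚ) * (oneFacePoly (m + 1)).eval x = hookSum (m + 1) x := by
  set u : Perm (Fin (m + 1)) → ℚ := fun σ => x ^ cycleCount σ with hu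
  have hconj : ∀ σ τ, u (τ * σ * τ⁻¹) = u σ := fun σ τ => by
    simp only [hu, cycleCount_conj]
  have hswap : ∀ (τ : Perm (Fin (m + 1))) (i t : Fin (m + 1)), τ t = t → i ≠ t →
      u (τ * swap i t) = x⁻¹ * u τ := by
    intro τ i t ht hit
    simp only [hu]
    rw [← cycleCount_mul_swap τ ht hit, pow_succ]
    field_simp
  have hone : u 1 = x ^ Fintype.card (Fin (m + 1)) := by
    simp only [hu, cycleCount_one, Fintype.card_fin]
  have hρ : ∀ z, ((finRotate (m + 1))⁻¹).SameCycle 0 z := fun z =>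
    Perm.sameCycle_inv.2 (sameCycle_finRotate z)
  have h := sum_signed_powerset (F := pairWeight u) 0 (pairWeight_conj hconj) hρ
  rw [Fintype.card_fin, ← eval_oneFacePoly] at h
  rw [← h]
  have h2 : ∀ B ∈ (univ.erase (0 : Fin (m + 1))).powerset,
      (-1 : ℚ) ^ #B * ∑ p ∈ permsOn (insert 0 B), ∑ q ∈ permsOn Bᶜ,
        ((Perm.sign p : ℤ) : ℚ) * pairWeight u (p * q) =
      (-1) ^ #B * (∏ j ∈ range (m + 1), (x - #B + j)) ^ 2 := by
    intro B hB
    rw [sum_sign_mul_pairWeight hx hswap hone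
      fun h => notMem_erase 0 univ (mem_powerset.1 hB h), Fintype.card_fin]
  rw [sum_congr rfl h2, sum_powerset_apply_card
    (fun k : ℕ => (-1 : ℚ) ^ k * (∏ j ∈ range (m + 1), (x - k + j)) ^ 2), hookSum]
  simp only [card_erase_of_mem (mem_univ _), card_univ, Fintype.card_fin, Nat.add_sub_cancel,
    nsmul_eq_mul]
  exact sum_congr rfl fun k _ => by ring

theorem eq_of_eval_eq_of_ne_zero {p q : ℚ[X]} (h : ∀ x ≠ 0, p.eval x = q.eval x) : p = q :=
  eq_of_infinite_eval_eq p q ((Set.finite_singleton (0 : ℚ)).infinite_compl.mono h)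

theorem oneFacePoly_recursion (m : ℕ) :
    C (m + 4 : ℚ) * oneFacePoly (m + 3) =
      C (2 * (2 * m + 5) : ℚ) * (X * oneFacePoly (m + 2)) +
        C ((m + 2) ^ 2 * (m + 1) : ℚ) * oneFacePoly (m + 1) := by
  refine eq_of_eval_eq_of_ne_zero fun x hx => ?_
  have h := hookSum_recursion m x
  rw [← factorial_mul_eval_oneFacePoly _ hx, ← factorial_mul_eval_oneFacePoly _ hx,
    ← factorial_mul_eval_oneFacePoly _ hx, Nat.factorial_succ (m + 2),
    Nat.factorial_succ (m + 1)] at h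
  simp only [eval_add, eval_mul, eval_C, eval_X]
  have h0 : ((m + 1).factorial : ℚ) * ((m + 2) * (m + 3)) ≠ 0 := by positivity
  refine mul_left_cancel₀ h0 ?_
  push_cast at h
  linear_combination h

theorem oneFacePoly_one : oneFacePoly 1 = X ^ 2 := by
  refine eq_of_eval_eq_of_ne_zero fun x hx => ?_
  have h := factorial_mul_eval_oneFacePoly 0 hx
  simpa [hookSum] using h

theorem oneFacePoly_two : oneFacePoly 2 = C 2 * X ^ 3 := by
  refine eq_of_eval_eq_of_ne_zero fun x hx => ?_
  have h := factorial_mul_eval_oneFacePoly 1 hx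
  simp [hookSum, sum_range_succ, prod_range_succ] at h
  simp only [eval_mul, eval_C, eval_pow, eval_X]
  linarith

theorem coeff_oneFacePoly_eq_zero (m : ℕ) {e : ℕ} (he : m + 2 < e) :
    (oneFacePoly (m + 1)).coeff e = 0 := by
  induction m using Nat.strong_induction_on generalizing e with
  | _ m ih =>
    match m with
    | 0 => rw [oneFacePoly_one, coeff_X_pow, if_neg (by omega)]
    | 1 => rw [oneFacePoly_two, coeff_C_mul, coeff_X_pow, if_neg (by omega), mul_zero]
    | m + 2 =>
      obtain ⟨e, rfl⟩ : ∃ e', e = e' + 1 := ⟨e - 1, by omega⟩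
      have h := congrArg (fun p => p.coeff (e + 1)) (oneFacePoly_recursion m)
      simp only [coeff_add, coeff_C_mul, coeff_X_mul] at h
      rw [ih (m + 1) (by omega) (by omega), ih m (by omega) (by omega)] at h
      have h0 : (m + 4 : ℚ) ≠ 0 := by positivity
      exact (mul_eq_zero.1 (h.trans (by ring))).resolve_left h0

theorem coeff_oneFacePoly (n e : ℕ) :
    (oneFacePoly n).coeff e = (Nat.card {p : Perm (Fin n) × Perm (Fin n) //
      p.1 * p.2 = finRotate n ∧ cycleCount p.1 + cycleCount p.2 = e} : ℚ) := by
  classical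
  rw [oneFacePoly, finsetSum_coeff, Nat.card_eq_fintype_card, Fintype.card_subtype]
  simp only [coeff_X_pow, sum_boole, filter_filter, eq_comm (a := e)]

theorem b_eq_coeff {g : ℤ} {m e : ℕ} (he : (e : ℤ) = (m + 1 : ℕ) + 1 - 2 * g) :
    (b g (m + 1) : ℚ) = (oneFacePoly (m + 1)).coeff e := by
  rw [b]
  split_ifs with hg
  · rw [coeff_oneFacePoly_eq_zero m (by omega), Int.cast_zero]
  · rw [coeff_oneFacePoly, ← he]
    norm_cast

theorem b_eq_zero {g : ℤ} {d : ℕ} (h : (d : ℤ) + 1 - 2 * g < 0) : b g d = 0 := by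
  rw [b]
  split_ifs with hg
  · rfl
  · rw [Nat.cast_eq_zero, Nat.card_eq_zero]
    exact Or.inl ⟨fun p => by have := p.2.2; omega⟩

end OneFace

end Factorizations

/-- The Do–Norbury recursion for one-face dessin d'enfant numbers. -/
theorem do_norbury (g : ℤ) (d : ℕ) (hg : 0 ≤ g) (hd : 3 ≤ d) :
    ((d : ℤ) + 1) * b g d =
      2 * (2 * (d : ℤ) - 1) * b g (d - 1) +
        ((d : ℤ) - 1) ^ 2 * ((d : ℤ) - 2) * b (g - 1) (d - 2) := by
  obtain ⟨m, rfl⟩ : ∃ m, d = m + 3 := ⟨d - 3, by omega⟩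
  rw [show m + 3 - 1 = m + 2 by omega, show m + 3 - 2 = m + 1 by omega]
  rcases lt_or_ge (((m + 3 : ℕ) : ℤ) + 1 - 2 * g) 0 with hneg | hpos
  · rw [b_eq_zero hneg, b_eq_zero (by push_cast at hneg ⊢; linarith),
      b_eq_zero (by push_cast at hneg ⊢; linarith)]
    ring
  obtain ⟨e, he⟩ := Int.eq_ofNat_of_zero_le hpos
  have h := congrArg (fun p => p.coeff e) (oneFacePoly_recursion m)
  have h2 : (Polynomial.X * oneFacePoly (m + 2)).coeff e = (b g (m + 2) : ℚ) := by
    rcases e with _ | e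
    · rw [Polynomial.coeff_X_mul_zero, b_eq_zero (by push_cast at he ⊢; linarith), Int.cast_zero]
    · rw [Polynomial.coeff_X_mul, b_eq_coeff (m := m + 1) (by push_cast at he ⊢; linarith)]
  simp only [Polynomial.coeff_add, Polynomial.coeff_C_mul] at h
  rw [h2, ← b_eq_coeff (g := g) (m := m + 2) he.symm,
    ← b_eq_coeff (g := g - 1) (m := m) (by push_cast at he ⊢; linarith)] at h
  have : (((m + 3 : ℕ) : ℚ) + 1) * b g (m + 3) =
      2 * (2 * ((m + 3 : ℕ) : ℚ) - 1) * b g (m + 2) +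
        (((m + 3 : ℕ) : ℚ) - 1) ^ 2 * (((m + 3 : ℕ) : ℚ) - 2) * b (g - 1) (m + 1) := by
    push_cast
    linear_combination h
  exact_mod_cast this
end

section
/- (1-point recursion for 3-hypermaps) Let γ = (1 2 … 3d) be the standard 3d-cycle in S_{3d}, and for integers g ≥ 0 and d ≥ 1 let a³_g(d) be the number of permutations τ ∈ S_{3d} of cycle type (3,3,…,3) (d three-cycles) such that γ∘τ has exactly 2d+1−2g cycles (this counts genus-g 3-hypermaps with one face of degree 3d). With the convention a³_g(d) = 0 for g < 0, for all integers g ≥ 0 and d ≥ 4 one has 2d(2d+1)·a³_g(d) = 3(3d−1)(3d−2)·a³_g(d−1) + (3d−1)(3d−2)(9d²−8d+2)·a³_{g−1}(d−1) − (d−1)(3d−1)(3d−2)(3d−4)(3d−5)(6d−7)·a³_{g−2}(d−2) + (d−1)(d−2)(3d−1)(3d−2)(3d−4)(3d−5)(3d−7)(3d−8)·a³_{g−3}(d−3). -/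
/-- `a3 g d` is the number of permutations `τ` of cycle type `(3, 3, …, 3)` (with `d`
three-cycles) in the symmetric group on `3d` letters such that `γ ∘ τ` has exactly
`2d + 1 - 2g` cycles, where `γ` is the standard `3d`-cycle; by convention it is `0`
for `g < 0`. -/
noncomputable def a3 (g : ℤ) (d : ℕ) : ℤ :=
  if g < 0 then 0 else
    (Nat.card {τ : Equiv.Perm (Fin (3 * d)) //
      τ.cycleType = Multiset.replicate d 3 ∧
      (cycleCount (finRotate (3 * d) * τ) : ℤ) = 2 * (d : ℤ) + 1 - 2 * g} : ℤ)

section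

open Equiv Equiv.Perm Finset

section

variable {α : Type*} [Fintype α] [DecidableEq α]

theorem Derivation.map_prod_erase {R A ι : Type*} [CommRing R] [CommRing A] [Algebra R A]
    [DecidableEq ι] (D : Derivation R A A) (s : Finset ι) (f : ι → A) :
    D (∏ i ∈ s, f i) = ∑ i ∈ s, (∏ j ∈ s.erase i, f j) * D (f i) := by
  induction s using Finset.induction_on with
  | empty => simp
  | insert a s ha ih =>
    rw [prod_insert ha, D.leibniz, ih, sum_insert ha, erase_insert ha, smul_eq_mul, smul_eq_mul,
      mul_sum, add_comm]
    congr 1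
    refine sum_congr rfl fun i hi => ?_
    rw [erase_insert_of_ne (by rintro rfl; exact ha hi), prod_insert (by simp [ha]), mul_assoc]

/-- Jacobi's formula for the derivative of a determinant. -/
theorem Derivation.map_det {R A : Type*} [CommRing R] [CommRing A] [Algebra R A]
    (D : Derivation R A A) (M : Matrix α α A) :
    D M.det = (M.adjugate * M.map D).trace := by
  have key : ∀ i, ((M.adjugate * M.map D) i i) =
      ∑ σ : Perm α, (sign σ : ℤ) • ((∏ j ∈ univ.erase i, M (σ j) j) * D (M (σ i) i)) := by
    intro i
    have h : (M.adjugate * M.map D) i i = (M.updateCol i fun k => D (M k i)).det := by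
      rw [← Matrix.cramer_apply, Matrix.cramer_eq_adjugate_mulVec]
      rfl
    rw [h, Matrix.det_apply]
    refine sum_congr rfl fun σ _ => ?_
    rw [← Finset.mul_prod_erase univ _ (mem_univ i), Matrix.updateCol_self, mul_comm]
    congr 2
    refine prod_congr rfl fun j hj => ?_
    rw [Matrix.updateCol_ne (ne_of_mem_erase hj)]
  rw [Matrix.trace, Matrix.det_apply, map_sum]
  simp only [Matrix.diag_apply, key]
  rw [sum_comm]
  refine sum_congr rfl fun σ _ => ?_
  rw [← smul_sum, ← D.map_prod_erase]
  exact map_zsmul D _ _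

end

namespace Equiv.Perm

/-- The number of orbits of a permutation. -/
noncomputable def orbitCount {α : Type*} (σ : Perm α) : ℕ :=
  Nat.card (Quotient (SameCycle.setoid σ))

section

variable {α β : Type*}

theorem apply_eq_of_sameCycle {σ : Perm α} {f : α → β} (hf : ∀ a, f (σ a) = f a) {a b : α}
    (h : σ.SameCycle a b) : f a = f b := by
  obtain ⟨k, rfl⟩ := h
  induction k using Int.induction_on with
  | zero => simp
  | succ k ih => rw [add_comm, zpow_add, zpow_one, mul_apply, hf, ih]
  | pred k ih =>
    rw [ih, ← hf ((σ ^ (-(k : ℤ) - 1)) a), ← mul_apply, ← zpow_one_add]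
    congr 3
    ring

/-- Functions invariant under `σ` are functions on the set of orbits. -/
def invariantEquiv (σ : Perm α) (β : Type*) :
    {f : α → β // ∀ a, f (σ a) = f a} ≃ (Quotient (SameCycle.setoid σ) → β) where
  toFun f := Quotient.lift f.1 fun _ _ h => apply_eq_of_sameCycle f.2 h
  invFun g := ⟨fun a => g (Quotient.mk _ a), fun a =>
    congrArg g (Quotient.sound (sameCycle_apply_left.2 (SameCycle.refl σ a)))⟩
  left_inv _ := rfl
  right_inv g := by
    ext q
    induction q using Quotient.inductionOn
    rfl

theorem card_invariant [Finite α] (σ : Perm α) (N : ℕ) :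
    Nat.card {f : α → Fin N // ∀ a, f (σ a) = f a} = N ^ orbitCount σ := by
  rw [Nat.card_congr (invariantEquiv σ (Fin N)), Nat.card_fun, Nat.card_fin, orbitCount]

theorem orbitCount_eq_of_equiv [Finite α] [Finite β] {σ : Perm α} {τ : Perm β} (k : ℕ)
    (e : {f : α → Fin 2 // ∀ a, f (σ a) = f a} ≃
      (Fin k → Fin 2) × {f : β → Fin 2 // ∀ a, f (τ a) = f a}) :
    orbitCount σ = k + orbitCount τ := by
  have h := Nat.card_congr e
  rw [Nat.card_prod, card_invariant, card_invariant, Nat.card_fun, Nat.card_fin, Nat.card_fin,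
    ← pow_add] at h
  exact Nat.pow_right_injective le_rfl h

theorem orbitCount_permCongr (e : α ≃ β) (σ : Perm α) :
    orbitCount (e.permCongr σ) = orbitCount σ := by
  refine (Nat.card_congr (Quotient.congr e fun a b => ?_)).symm
  change σ.SameCycle a b ↔ (e.permCongr σ).SameCycle (e a) (e b)
  refine exists_congr fun i => ?_
  have : (e.permCongr σ) ^ i = e.permCongr (σ ^ i) := (map_zpow e.permCongrHom σ i).symm
  simp [this, permCongr_apply]

theorem orbitCount_conj (σ τ : Perm α) : orbitCount (τ * σ * τ⁻¹) = orbitCount σ :=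
  orbitCount_permCongr τ σ

theorem orbitCount_mul_comm (σ τ : Perm α) : orbitCount (σ * τ) = orbitCount (τ * σ) := by
  rw [← orbitCount_conj (τ * σ) σ]
  group

theorem orbitCount_pos [Finite α] [Nonempty α] (σ : Perm α) : 0 < orbitCount σ :=
  have : Nonempty (Quotient (SameCycle.setoid σ)) := ⟨Quotient.mk _ (Classical.arbitrary α)⟩
  Nat.card_pos

theorem orbitCount_optionCongr [Finite α] (σ : Perm α) :
    orbitCount (optionCongr σ : Perm (Option α)) = 1 + orbitCount σ := by
  refine orbitCount_eq_of_equiv 1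
    ⟨fun f => (fun _ => f.1 none, ⟨fun a => f.1 (some a), fun a => f.2 (some a)⟩),
      fun p => ⟨fun o => o.elim (p.1 0) p.2.1, fun o => ?_⟩, fun f => ?_, fun p => ?_⟩
  · cases o with
    | none => rfl
    | some a => exact p.2.2 a
  · ext o
    cases o <;> rfl
  · ext i
    · fin_cases i
      rfl
    · rfl

theorem orbitCount_optionCongr_mul_swap [Finite α] [DecidableEq α] (σ : Perm α) (i : α) :
    orbitCount ((optionCongr σ : Perm (Option α)) * swap none (some i)) = orbitCount σ := by
  rw [← zero_add (orbitCount σ)]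
  have key : ∀ f : Option α → Fin 2,
      (∀ a, f (((optionCongr σ : Perm (Option α)) * swap none (some i)) a) = f a) →
      f none = f (some i) ∧ ∀ a, f (some (σ a)) = f (some a) := by
    intro f hf
    have h1 : f none = f (some i) := by simpa using hf (some i)
    refine ⟨h1, fun a => ?_⟩
    by_cases h : a = i
    · subst h
      simpa [h1] using hf none
    · simpa [swap_apply_of_ne_of_ne, h] using hf (some a)
  refine orbitCount_eq_of_equiv 0
    ⟨fun f => (fun _ => 0, ⟨fun a => f.1 (some a), (key f.1 f.2).2⟩),
      fun p => ⟨fun o => p.2.1 (o.elim i id), fun o => ?_⟩, fun f => ?_, fun p => ?_⟩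
  · cases o with
    | none => simpa using p.2.2 i
    | some a =>
      by_cases h : a = i
      · subst h
        simp
      · simpa [swap_apply_of_ne_of_ne, h] using p.2.2 a
  · ext o
    cases o with
    | none => simp [(key f.1 f.2).1]
    | some a => rfl
  · ext i
    · exact i.elim0
    · rfl

theorem orbitCount_eq_card_cycleType [Fintype α] [DecidableEq α] (σ : Perm α) :
    orbitCount σ = Multiset.card σ.cycleType + (Fintype.card α - σ.cycleType.sum) := by
  classical
  let F : α → σ.cycleFactorsFinset ⊕ {a // σ a = a} := fun a =>
    if h : σ a = a then .inr ⟨a, h⟩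
    else .inl ⟨σ.cycleOf a, cycleOf_mem_cycleFactorsFinset_iff.2 (mem_support.2 h)⟩
  have hF : Function.Surjective F := by
    rintro (⟨c, hc⟩ | ⟨a, ha⟩)
    · obtain ⟨a, ha⟩ := (mem_cycleFactorsFinset_iff.1 hc).1.nonempty_support
      have h : σ a ≠ a := mem_support.1 (mem_cycleFactorsFinset_support_le hc ha)
      exact ⟨a, by simp [F, h, cycle_is_cycleOf ha hc]⟩
    · exact ⟨a, by simp [F, ha]⟩
  have hker : SameCycle.setoid σ = Setoid.ker F := by
    ext a b
    change σ.SameCycle a b ↔ F a = F b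
    by_cases ha : σ a = a <;> by_cases hb : σ b = b
    · simp only [F, ha, hb, dite_true, Sum.inr.injEq, Subtype.mk.injEq]
      exact ⟨fun h => (h.eq_of_left ha), fun h => h ▸ SameCycle.refl _ _⟩
    · simp only [F, ha, hb, dite_true, dite_false, reduceCtorEq, iff_false]
      exact fun h => hb (h.eq_of_left ha ▸ ha)
    · simp only [F, ha, hb, dite_true, dite_false, reduceCtorEq, iff_false]
      exact fun h => ha (h.eq_of_right hb ▸ hb)
    · simp only [F, ha, hb, dite_false, Sum.inl.injEq, Subtype.mk.injEq]
      exact sameCycle_iff_cycleOf_eq_of_mem_support (mem_support.2 ha) (mem_support.2 hb)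
  have h1 : orbitCount σ = Nat.card (Quotient (Setoid.ker F)) := by rw [orbitCount, hker]
  rw [h1, Nat.card_congr (Setoid.quotientKerEquivOfSurjective F hF), Nat.card_sum]
  congr 1
  · simp [cycleType_def]
  · rw [sum_cycleType, ← Finset.card_compl, Nat.card_eq_fintype_card, Fintype.card_subtype]
    congr 1
    ext a
    simp

end

section

variable {α β : Type*}

open PowerSeries in
/-- The generating series whose `N`-th coefficient is the sum of `N ^ orbitCount (σ * γ)` over all
permutations `γ` with a single orbit. -/
noncomputable def cycleSeries [Fintype α] [DecidableEq α] (σ : Perm α) : PowerSeries ℚ :=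
  PowerSeries.mk fun N => ∑ γ : Perm α with orbitCount γ = 1, (N : ℚ) ^ orbitCount (σ * γ)

theorem sum_orbitCount_eq_one_option [Fintype α] [DecidableEq α] [Nonempty α]
    (F : Perm (Option α) → ℚ) :
    ∑ γ : Perm (Option α) with orbitCount γ = 1, F γ =
      ∑ i, ∑ γ : Perm α with orbitCount γ = 1, F (swap none (some i) * optionCongr γ) := by
  rw [sum_filter, ← Equiv.sum_comp decomposeOption.symm, Fintype.sum_prod_type, Fintype.sum_option]
  have h0 : ∀ γ : Perm α, orbitCount (decomposeOption.symm (none, γ)) ≠ 1 := fun γ => by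
    have := orbitCount_pos γ
    have h : decomposeOption.symm (none, γ) = optionCongr γ := by
      ext1 a
      simp
    rw [h, orbitCount_optionCongr]
    omega
  have h1 : ∀ i, ∀ γ : Perm α,
      orbitCount (decomposeOption.symm (some i, γ)) = orbitCount γ := fun i γ => by
    rw [decomposeOption_symm_apply, orbitCount_mul_comm, orbitCount_optionCongr_mul_swap]
  simp only [h0, h1, if_false, sum_const_zero, zero_add, sum_filter]
  rfl

theorem optionCongr_mul (σ τ : Perm α) :
    (optionCongr (σ * τ) : Perm (Option α)) = optionCongr σ * optionCongr τ := by
  ext1 a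
  cases a <;> rfl

theorem cycleSeries_optionCongr [Fintype α] [DecidableEq α] [Nonempty α] (τ : Perm α) :
    cycleSeries (optionCongr τ : Perm (Option α)) =
      (Fintype.card α : PowerSeries ℚ) * cycleSeries τ := by
  ext N
  rw [← map_natCast (PowerSeries.C (R := ℚ)), PowerSeries.coeff_C_mul]
  simp only [cycleSeries, PowerSeries.coeff_mk, sum_orbitCount_eq_one_option]
  rw [← Finset.card_univ, ← nsmul_eq_mul]
  refine Finset.sum_eq_card_nsmul fun i _ => sum_congr rfl fun γ _ => ?_
  rw [orbitCount_mul_comm, mul_assoc, ← optionCongr_mul, orbitCount_mul_comm,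
    orbitCount_optionCongr_mul_swap, orbitCount_mul_comm]

theorem orbitCount_swap_mul_swap [Finite α] [DecidableEq α] (τ γ : Perm α) {i j : α} (h : i ≠ j) :
    orbitCount (optionCongr τ * swap none (some j) * (swap none (some i) * optionCongr γ) :
      Perm (Option α)) = orbitCount (τ * swap i j * γ) := by
  have hs : (swap none (some j) * swap none (some i) : Perm (Option α)) =
      swap none (some i) * optionCongr (swap i j) := by
    have h' : some j ≠ some i := by simpa using h.symm
    rw [optionCongr_swap, mul_swap_eq_swap_mul (swap none (some i)) (some i) (some j),
      swap_apply_right, swap_apply_of_ne_of_ne (by simp) h']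
  rw [mul_assoc, ← mul_assoc (swap none (some j)), hs, orbitCount_mul_comm, mul_assoc, mul_assoc,
    ← optionCongr_mul, ← optionCongr_mul, orbitCount_mul_comm, orbitCount_optionCongr_mul_swap,
    orbitCount_mul_comm, mul_assoc, mul_assoc, orbitCount_mul_comm]
  simp only [mul_assoc]

theorem cycleSeries_optionCongr_mul_swap [Fintype α] [DecidableEq α] (τ : Perm α) (j : α) :
    cycleSeries (optionCongr τ * swap none (some j) : Perm (Option α)) =
      PowerSeries.X * PowerSeries.derivative ℚ (cycleSeries τ) +
        ∑ i with i ≠ j, cycleSeries (τ * swap i j) := by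
  have : Nonempty α := ⟨j⟩
  ext N
  have hX : PowerSeries.coeff N (PowerSeries.X * PowerSeries.derivative ℚ (cycleSeries τ)) =
      N * PowerSeries.coeff N (cycleSeries τ) := by
    cases N with
    | zero => simp
    | succ N =>
      rw [PowerSeries.coeff_succ_X_mul, PowerSeries.coeff_derivative]
      push_cast
      ring
  rw [map_add, hX, map_sum]
  simp only [cycleSeries, PowerSeries.coeff_mk, sum_orbitCount_eq_one_option]
  rw [← Finset.sum_filter_add_sum_filter_not univ (fun i => i = j), filter_eq' univ j,
    if_pos (mem_univ j), sum_singleton, mul_sum]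
  congr 1
  · refine sum_congr rfl fun γ _ => ?_
    rw [mul_assoc, swap_mul_self_mul, ← optionCongr_mul, orbitCount_optionCongr, pow_add, pow_one]
  · refine sum_congr rfl fun i hi => sum_congr rfl fun γ _ => ?_
    rw [orbitCount_swap_mul_swap τ γ (mem_filter.1 hi).2]

theorem cycleSeries_permCongr [Fintype α] [DecidableEq α] [Fintype β] [DecidableEq β]
    (e : α ≃ β) (σ : Perm α) : cycleSeries (e.permCongr σ) = cycleSeries σ := by
  ext N
  simp only [cycleSeries, PowerSeries.coeff_mk, sum_filter]
  rw [← Equiv.sum_comp e.permCongr]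
  refine sum_congr rfl fun γ _ => ?_
  rw [← permCongr_mul, orbitCount_permCongr, orbitCount_permCongr]

end

section

open PowerSeries

variable {α β : Type*} [DecidableEq α] [DecidableEq β]

/-- The matrix `1 - X P`, where `P` is the permutation matrix of `σ`. -/
noncomputable def cycleMatrix (σ : Perm α) : Matrix α α ℚ⟦X⟧ :=
  1 - (X : ℚ⟦X⟧) • σ.permMatrix ℚ⟦X⟧

theorem cycleMatrix_apply (σ : Perm α) (a b : α) :
    cycleMatrix σ a b = (if a = b then 1 else 0) - X * (if σ a = b then 1 else 0) := by
  simp [cycleMatrix, Matrix.one_apply, PEquiv.toMatrix_apply, eq_comm]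

variable [Fintype α] [Fintype β]

theorem cycleMatrix_mul_apply (σ : Perm α) (B : Matrix α α ℚ⟦X⟧) (a b : α) :
    (cycleMatrix σ * B) a b = B a b - X * B (σ a) b := by
  simp [Matrix.mul_apply, cycleMatrix_apply, sub_mul, sum_sub_distrib]

theorem mul_cycleMatrix_apply (σ : Perm α) (B : Matrix α α ℚ⟦X⟧) (a b : α) :
    (B * cycleMatrix σ) a (σ b) = B a (σ b) - X * B a b := by
  simp [Matrix.mul_apply, cycleMatrix_apply, mul_sub, sum_sub_distrib, mul_comm]

theorem constantCoeff_det_cycleMatrix (σ : Perm α) : constantCoeff (cycleMatrix σ).det = 1 := by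
  rw [RingHom.map_det]
  have : (constantCoeff (R := ℚ)).mapMatrix (cycleMatrix σ) = 1 := by
    ext a b
    rw [RingHom.mapMatrix_apply, Matrix.map_apply, cycleMatrix_apply, Matrix.one_apply]
    split_ifs <;> simp
  rw [this, Matrix.det_one]

theorem isUnit_det_cycleMatrix (σ : Perm α) : IsUnit (cycleMatrix σ).det := by
  rw [isUnit_iff_constantCoeff, constantCoeff_det_cycleMatrix]
  exact isUnit_one

theorem cycleMatrix_inv_apply (σ : Perm α) (a b : α) :
    (cycleMatrix σ)⁻¹ a b - X * (cycleMatrix σ)⁻¹ (σ a) b = if a = b then 1 else 0 := by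
  rw [← cycleMatrix_mul_apply, Matrix.mul_nonsing_inv _ (isUnit_det_cycleMatrix σ),
    Matrix.one_apply]

theorem cycleMatrix_inv_apply' (σ : Perm α) (a b : α) :
    (cycleMatrix σ)⁻¹ a (σ b) - X * (cycleMatrix σ)⁻¹ a b = if a = σ b then 1 else 0 := by
  rw [← mul_cycleMatrix_apply, Matrix.nonsing_inv_mul _ (isUnit_det_cycleMatrix σ),
    Matrix.one_apply]

theorem sum_cycleMatrix_inv_left (σ : Perm α) (b : α) :
    (1 - X) * ∑ a, (cycleMatrix σ)⁻¹ a b = 1 := by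
  have h := Finset.sum_congr (rfl : (univ : Finset α) = univ)
    fun a _ => cycleMatrix_inv_apply σ a b
  rw [sum_sub_distrib, ← mul_sum, Equiv.sum_comp σ fun a => (cycleMatrix σ)⁻¹ a b] at h
  rw [sub_mul, one_mul, h]
  simp

theorem sum_cycleMatrix_inv_right (σ : Perm α) (a : α) :
    (1 - X) * ∑ b, (cycleMatrix σ)⁻¹ a b = 1 := by
  have h := Finset.sum_congr (rfl : (univ : Finset α) = univ)
    fun b _ => cycleMatrix_inv_apply' σ a b
  rw [sum_sub_distrib, ← mul_sum, Equiv.sum_comp σ fun b => (cycleMatrix σ)⁻¹ a b,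
    Equiv.sum_comp σ fun b => if a = b then (1 : ℚ⟦X⟧) else 0] at h
  rw [sub_mul, one_mul, h]
  simp

theorem det_cycleMatrix_mul_swap (σ : Perm α) {i j : α} (h : i ≠ j) :
    (cycleMatrix (σ * swap i j)).det = (cycleMatrix σ).det *
      ((cycleMatrix σ)⁻¹ i i + (cycleMatrix σ)⁻¹ j j - (cycleMatrix σ)⁻¹ i j -
        (cycleMatrix σ)⁻¹ j i - 1) := by
  have hM : cycleMatrix (σ * swap i j) = cycleMatrix σ +
      Matrix.replicateCol Unit
          (fun a => (X : ℚ⟦X⟧) * ((if a = i then 1 else 0) - (if a = j then 1 else 0))) *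
      Matrix.replicateRow Unit
        (fun b => (if σ i = b then (1 : ℚ⟦X⟧) else 0) - (if σ j = b then 1 else 0)) := by
    ext1 a b
    simp only [cycleMatrix_apply, Matrix.add_apply, Matrix.mul_apply, Matrix.replicateCol_apply,
      Matrix.replicateRow_apply, univ_unique, sum_singleton, mul_apply]
    by_cases hi : a = i
    · subst hi
      simp only [swap_apply_left, h, if_true, if_false]
      ring
    · by_cases hj : a = j
      · subst hj
        simp only [swap_apply_right, hi, if_true, if_false]
        ring
      · simp only [swap_apply_of_ne_of_ne hi hj, hi, hj, if_false]
        ring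
  rw [hM, Matrix.det_add_replicateCol_mul_replicateRow (isUnit_det_cycleMatrix σ)]
  congr 1
  have e1 := cycleMatrix_inv_apply σ i i
  have e2 := cycleMatrix_inv_apply σ i j
  have e3 := cycleMatrix_inv_apply σ j i
  have e4 := cycleMatrix_inv_apply σ j j
  simp only [h, h.symm, if_true, if_false] at e1 e2 e3 e4
  have : (Matrix.replicateRow Unit (fun b => (if σ i = b then (1 : ℚ⟦X⟧) else 0) -
      (if σ j = b then 1 else 0)) * (cycleMatrix σ)⁻¹ * Matrix.replicateCol Unit
      (fun a => (X : ℚ⟦X⟧) * ((if a = i then 1 else 0) - (if a = j then 1 else 0)))) () () =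
      X * ((cycleMatrix σ)⁻¹ (σ i) i - (cycleMatrix σ)⁻¹ (σ j) i - (cycleMatrix σ)⁻¹ (σ i) j +
        (cycleMatrix σ)⁻¹ (σ j) j) := by
    simp [Matrix.mul_apply, sub_mul, mul_sub, sum_sub_distrib]
    ring
  rw [Matrix.det_unique, Matrix.add_apply, Matrix.one_apply_eq]
  refine (congrArg (1 + ·) this).trans ?_
  linear_combination e2 + e3 - e1 - e4

theorem X_mul_derivative_det_cycleMatrix (σ : Perm α) :
    X * derivative ℚ (cycleMatrix σ).det = (cycleMatrix σ).det *
      ((Fintype.card α : ℚ⟦X⟧) - (cycleMatrix σ)⁻¹.trace) := by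
  have hD : (X : ℚ⟦X⟧) • (cycleMatrix σ).map (derivative ℚ) = cycleMatrix σ - 1 := by
    ext1 a b
    simp only [Matrix.smul_apply, Matrix.map_apply, Matrix.sub_apply, cycleMatrix_apply,
      Matrix.one_apply]
    split_ifs <;> simp
  have hadj : (cycleMatrix σ).adjugate = (cycleMatrix σ).det • (cycleMatrix σ)⁻¹ := by
    rw [Matrix.inv_def, smul_smul, Ring.mul_inverse_cancel _ (isUnit_det_cycleMatrix σ), one_smul]
  rw [Derivation.map_det, ← smul_eq_mul, ← Matrix.trace_smul, ← Matrix.mul_smul, hD, hadj, mul_sub,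
    Matrix.smul_mul, Matrix.nonsing_inv_mul _ (isUnit_det_cycleMatrix σ), mul_one, ← smul_sub,
    Matrix.trace_smul, Matrix.trace_sub, Matrix.trace_one, smul_eq_mul]

theorem det_cycleMatrix_permCongr (e : α ≃ β) (σ : Perm α) :
    (cycleMatrix (e.permCongr σ)).det = (cycleMatrix σ).det := by
  rw [← Matrix.det_submatrix_equiv_self e]
  congr 1
  ext1 a b
  simp [cycleMatrix_apply]

theorem det_cycleMatrix_optionCongr (τ : Perm α) :
    (cycleMatrix (optionCongr τ : Perm (Option α))).det = (1 - X) * (cycleMatrix τ).det := by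
  rw [← Matrix.det_submatrix_equiv_self (optionEquivSumPUnit.{0} α).symm]
  have : (cycleMatrix (optionCongr τ : Perm (Option α))).submatrix (optionEquivSumPUnit.{0} α).symm
      (optionEquivSumPUnit.{0} α).symm =
      Matrix.fromBlocks (cycleMatrix τ) 0 0 (Matrix.of fun _ _ => 1 - X) := by
    ext1 a b
    rcases a with a | a <;> rcases b with b | b <;> simp [cycleMatrix_apply]
  rw [this, Matrix.det_fromBlocks_zero₂₁, mul_comm]
  exact congrArg (· * _) (Matrix.det_unique _)

theorem one_sub_X_ne_zero : (1 - X : ℚ⟦X⟧) ≠ 0 := fun h => by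
  simpa using congrArg constantCoeff h

theorem cycleMatrix_optionCongr_inv_none_none (τ : Perm α) :
    (1 - X) * (cycleMatrix (optionCongr τ : Perm (Option α)))⁻¹ none none = 1 := by
  have := cycleMatrix_inv_apply (optionCongr τ : Perm (Option α)) none none
  simp only [optionCongr_apply, Option.map_none, if_true] at this
  linear_combination this

theorem cycleMatrix_optionCongr_inv_none_some (τ : Perm α) (j : α) :
    (cycleMatrix (optionCongr τ : Perm (Option α)))⁻¹ none (some j) = 0 := by
  have := cycleMatrix_inv_apply (optionCongr τ : Perm (Option α)) none (some j)
  simp only [optionCongr_apply, Option.map_none, reduceCtorEq, if_false] at this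
  refine (mul_eq_zero_iff_left one_sub_X_ne_zero).1 ?_
  linear_combination this

theorem cycleMatrix_optionCongr_inv_some_none (τ : Perm α) (j : α) :
    (cycleMatrix (optionCongr τ : Perm (Option α)))⁻¹ (some j) none = 0 := by
  have := cycleMatrix_inv_apply' (optionCongr τ : Perm (Option α)) (some j) none
  simp only [optionCongr_apply, Option.map_none, reduceCtorEq, if_false] at this
  refine (mul_eq_zero_iff_left one_sub_X_ne_zero).1 ?_
  linear_combination this

theorem cycleMatrix_optionCongr_inv_some_some (τ : Perm α) (i j : α) :
    (cycleMatrix (optionCongr τ : Perm (Option α)))⁻¹ (some i) (some j) =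
      (cycleMatrix τ)⁻¹ i j := by
  have h : cycleMatrix τ * ((cycleMatrix (optionCongr τ : Perm (Option α)))⁻¹.submatrix
      some some) = 1 := by
    ext1 a b
    have := cycleMatrix_inv_apply (optionCongr τ : Perm (Option α)) (some a) (some b)
    simpa [cycleMatrix_mul_apply, Matrix.one_apply] using this
  rw [Matrix.inv_eq_right_inv h]
  rfl

theorem det_cycleMatrix_optionCongr_mul_swap (τ : Perm α) (j : α) :
    (cycleMatrix (optionCongr τ * swap none (some j) : Perm (Option α))).det =
      (cycleMatrix τ).det * (X + (1 - X) * (cycleMatrix τ)⁻¹ j j) := by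
  rw [det_cycleMatrix_mul_swap _ (by simp), det_cycleMatrix_optionCongr,
    cycleMatrix_optionCongr_inv_none_some, cycleMatrix_optionCongr_inv_some_none,
    cycleMatrix_optionCongr_inv_some_some]
  linear_combination (cycleMatrix τ).det * cycleMatrix_optionCongr_inv_none_none τ

theorem sum_det_cycleMatrix_mul_swap (τ : Perm α) (j : α) :
    (1 - X) * ∑ i with i ≠ j, (cycleMatrix (τ * swap i j)).det =
      (cycleMatrix τ).det * ((1 - X) * ((cycleMatrix τ)⁻¹.trace +
        (Fintype.card α : ℚ⟦X⟧) * (cycleMatrix τ)⁻¹ j j - ((Fintype.card α : ℚ⟦X⟧) - 1)) - 2) := by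
  have h1 : ∑ i with i ≠ j, (cycleMatrix (τ * swap i j)).det =
      ∑ i, (cycleMatrix τ).det * ((cycleMatrix τ)⁻¹ i i + (cycleMatrix τ)⁻¹ j j -
        (cycleMatrix τ)⁻¹ i j - (cycleMatrix τ)⁻¹ j i - 1 + if i = j then 1 else 0) := by
    rw [sum_filter]
    refine sum_congr rfl fun i _ => ?_
    by_cases h : i = j
    · subst h
      simp
    · simp [h, det_cycleMatrix_mul_swap]
  rw [h1, ← mul_sum]
  simp only [sum_add_distrib, sum_sub_distrib, sum_const, card_univ, nsmul_eq_mul, mul_one,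
    sum_ite_eq', mem_univ, if_true, Matrix.trace, Matrix.diag_apply]
  linear_combination -(cycleMatrix τ).det * (sum_cycleMatrix_inv_left τ j +
    sum_cycleMatrix_inv_right τ j)

theorem one_sub_X_sq_mul_mk : (1 - X) ^ 2 * PowerSeries.mk (fun N => (N : ℚ)) = X := by
  have h1 := mk_one_mul_one_sub_eq_one ℚ
  have h2 : PowerSeries.mk (fun N => (N : ℚ)) = X * derivative ℚ (PowerSeries.mk 1) := by
    ext N
    cases N with
    | zero => simp
    | succ N => simp [coeff_succ_X_mul, coeff_derivative]
  have h3 := congrArg (derivative ℚ) h1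
  simp only [Derivation.leibniz, smul_eq_mul, map_sub, derivative_X, derivative_one] at h3
  rw [h2]
  linear_combination X * (1 - X) * h3 + X * h1

theorem one_sub_X_pow_mul_cycleSeries_of_unique [Unique α] (σ : Perm α) :
    (1 - X) ^ (Fintype.card α + 2) * cycleSeries σ =
      ((Fintype.card α - 1).factorial : ℚ⟦X⟧) * X * (cycleMatrix σ).det := by
  have ho : ∀ γ : Perm α, orbitCount γ = 1 := fun γ => by
    have : Unique (Quotient (SameCycle.setoid γ)) :=
      { default := Quotient.mk _ default
        uniq := fun q => by
          induction q using Quotient.inductionOn with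
          | h a => rw [Subsingleton.elim a default] }
    exact Nat.card_unique
  have hG : cycleSeries σ = PowerSeries.mk (fun N => (N : ℚ)) := by
    ext N
    simp [cycleSeries, ho]
  have hdet : (cycleMatrix σ).det = 1 - X := by
    rw [Matrix.det_unique, cycleMatrix_apply]
    simp [Subsingleton.elim (σ default) default]
  rw [hG, hdet, Fintype.card_unique]
  simp only [Nat.sub_self, Nat.factorial_zero, Nat.cast_one]
  linear_combination (1 - X) * one_sub_X_sq_mul_mk

theorem one_sub_X_pow_mul_cycleSeries_optionCongr_mul_swap
    (h : ∀ σ : Perm α, (1 - X) ^ (Fintype.card α + 2) * cycleSeries σ =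
      ((Fintype.card α - 1).factorial : ℚ⟦X⟧) * X * (cycleMatrix σ).det) (τ : Perm α) (j : α) :
    (1 - X) ^ (Fintype.card α + 3) *
        cycleSeries (optionCongr τ * swap none (some j) : Perm (Option α)) =
      ((Fintype.card α).factorial : ℚ⟦X⟧) * X *
        (cycleMatrix (optionCongr τ * swap none (some j) : Perm (Option α))).det := by
  have : Nonempty α := ⟨j⟩
  have hf : ((Fintype.card α).factorial : ℚ⟦X⟧) =
      (Fintype.card α : ℚ⟦X⟧) * ((Fintype.card α - 1).factorial : ℚ⟦X⟧) := by
    rw [← Nat.cast_mul, Nat.mul_factorial_pred Fintype.card_ne_zero]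
  have hτ := h τ
  have hd := congrArg (derivative ℚ) hτ
  simp only [Derivation.leibniz, Derivation.leibniz_pow, smul_eq_mul, map_sub, derivative_X,
    derivative_one, Derivation.map_natCast, nsmul_eq_mul, Nat.cast_add, Nat.cast_ofNat] at hd
  rw [show Fintype.card α + 2 - 1 = Fintype.card α + 1 by omega] at hd
  have hsum : (1 - X) ^ (Fintype.card α + 2) * ∑ i with i ≠ j, cycleSeries (τ * swap i j) =
      ((Fintype.card α - 1).factorial : ℚ⟦X⟧) * X *
        ∑ i with i ≠ j, (cycleMatrix (τ * swap i j)).det := by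
    rw [mul_sum, mul_sum]
    exact sum_congr rfl fun i _ => h _
  have hs := sum_det_cycleMatrix_mul_swap τ j
  have hx := X_mul_derivative_det_cycleMatrix τ
  rw [cycleSeries_optionCongr_mul_swap, det_cycleMatrix_optionCongr_mul_swap, hf]
  linear_combination X * (1 - X) * hd + ((Fintype.card α : ℚ⟦X⟧) + 2) * X * hτ +
    (1 - X) * hsum + ((Fintype.card α - 1).factorial : ℚ⟦X⟧) * X * hs +
    ((Fintype.card α - 1).factorial : ℚ⟦X⟧) * X * (1 - X) * hx

theorem one_sub_X_pow_mul_cycleSeries_option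
    (ih : ∀ [Nonempty α] (σ : Perm α), (1 - X) ^ (Fintype.card α + 2) * cycleSeries σ =
      ((Fintype.card α - 1).factorial : ℚ⟦X⟧) * X * (cycleMatrix σ).det) (σ : Perm (Option α)) :
    (1 - X) ^ (Fintype.card (Option α) + 2) * cycleSeries σ =
      ((Fintype.card (Option α) - 1).factorial : ℚ⟦X⟧) * X * (cycleMatrix σ).det := by
  rcases isEmpty_or_nonempty α with hα | hα
  · exact one_sub_X_pow_mul_cycleSeries_of_unique σ
  · obtain ⟨⟨x, τ⟩, rfl⟩ := decomposeOption.symm.surjective σ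
    rw [Fintype.card_option, Nat.add_sub_cancel]
    cases x with
    | none =>
      have hf : ((Fintype.card α).factorial : ℚ⟦X⟧) =
          (Fintype.card α : ℚ⟦X⟧) * ((Fintype.card α - 1).factorial : ℚ⟦X⟧) := by
        rw [← Nat.cast_mul, Nat.mul_factorial_pred Fintype.card_ne_zero]
      have hτ : decomposeOption.symm (none, τ) = optionCongr τ := by
        ext1 a
        simp
      rw [hτ, cycleSeries_optionCongr, det_cycleMatrix_optionCongr, hf]
      linear_combination (1 - X) * (Fintype.card α : ℚ⟦X⟧) * ih τ
    | some k =>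
      have hτ : decomposeOption.symm (some k, τ) =
          optionCongr τ * swap none (some (τ⁻¹ k)) := by
        rw [decomposeOption_symm_apply, mul_swap_eq_swap_mul]
        simp
      rw [hτ]
      exact one_sub_X_pow_mul_cycleSeries_optionCongr_mul_swap ih τ _

theorem one_sub_X_pow_mul_cycleSeries {α : Type*} [Fintype α] [DecidableEq α] [Nonempty α]
    (σ : Perm α) :
    (1 - X) ^ (Fintype.card α + 2) * cycleSeries σ =
      ((Fintype.card α - 1).factorial : ℚ⟦X⟧) * X * (cycleMatrix σ).det := by
  refine Fintype.induction_empty_option (P := fun α _ => ∀ [DecidableEq α] [Nonempty α]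
    (σ : Perm α), (1 - X) ^ (Fintype.card α + 2) * cycleSeries σ =
      ((Fintype.card α - 1).factorial : ℚ⟦X⟧) * X * (cycleMatrix σ).det) ?_ ?_ ?_ α σ
  · intro α β _ e ih _ _ σ
    classical
    let := Fintype.ofEquiv β e.symm
    have : Nonempty α := e.nonempty
    have h := ih (e.symm.permCongr σ)
    rw [cycleSeries_permCongr, det_cycleMatrix_permCongr] at h
    convert h using 3
    · rw [Fintype.card_congr e.symm]
    · rw [Fintype.card_congr e.symm]
  · intro _ h
    exact h.elim PEmpty.elim
  · intro α _ ih hdec _ σ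
    classical
    convert one_sub_X_pow_mul_cycleSeries_option (fun τ => ih τ) σ

theorem derivative_one_sub_X_pow_three (d : ℕ) :
    (1 - X ^ 3) * derivative ℚ ((1 - X ^ 3 : ℚ⟦X⟧) ^ d) =
      -(3 * (d : ℚ⟦X⟧) * X ^ 2 * (1 - X ^ 3) ^ d) := by
  cases d with
  | zero => simp
  | succ d =>
    simp only [Derivation.leibniz_pow, smul_eq_mul, map_sub, derivative_X, derivative_one,
      nsmul_eq_mul]
    push_cast
    ring

theorem det_cycleMatrix_of_pow_three (d : ℕ) (hd : Fintype.card α = 3 * d) (σ : Perm α)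
    (h3 : σ ^ 3 = 1) (h1 : ∀ a, σ a ≠ a) :
    (cycleMatrix σ).det = (1 - X ^ 3) ^ d := by
  have h3' : ∀ a, σ (σ (σ a)) = a := fun a => by
    simpa [pow_succ] using congrArg (fun f : Perm α => f a) h3
  have h2 : ∀ a, σ (σ a) ≠ a := fun a h => h1 a (by simpa [h] using h3' a)
  have htr : (1 - X ^ 3) * (cycleMatrix σ)⁻¹.trace = (Fintype.card α : ℚ⟦X⟧) := by
    have : ∀ a, (1 - X ^ 3) * (cycleMatrix σ)⁻¹ a a = 1 := fun a => by
      have e1 := cycleMatrix_inv_apply σ a a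
      have e2 := cycleMatrix_inv_apply σ (σ a) a
      have e3 := cycleMatrix_inv_apply σ (σ (σ a)) a
      rw [if_pos rfl] at e1
      rw [if_neg (h1 a)] at e2
      rw [if_neg (h2 a), h3'] at e3
      linear_combination e1 + X * e2 + X ^ 2 * e3
    simp [Matrix.trace, mul_sum, this]
  have hx := X_mul_derivative_det_cycleMatrix σ
  have hne : (1 - X ^ 3 : ℚ⟦X⟧) ≠ 0 := fun h => by
    simpa using congrArg constantCoeff h
  have hD : (1 - X ^ 3) * derivative ℚ (cycleMatrix σ).det =
      -(3 * (d : ℚ⟦X⟧) * X ^ 2 * (cycleMatrix σ).det) := by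
    refine mul_left_cancel₀ (X_ne_zero (R := ℚ)) ?_
    have hn : (Fintype.card α : ℚ⟦X⟧) = 3 * d := by rw [hd]; push_cast; rfl
    rw [hn] at htr hx
    linear_combination (1 - X ^ 3) * hx - (cycleMatrix σ).det * htr
  have hE := derivative_one_sub_X_pow_three d
  have hunit : IsUnit ((1 - X ^ 3 : ℚ⟦X⟧) ^ d) := by
    rw [isUnit_iff_constantCoeff]
    simp
  obtain ⟨u, hu⟩ := hunit.exists_right_inv
  have hu' := congrArg (derivative ℚ) hu
  simp only [Derivation.leibniz, smul_eq_mul, derivative_one] at hu'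
  have hc : (cycleMatrix σ).det * u = 1 := by
    refine derivative.ext ?_ ?_
    · refine (mul_eq_zero_iff_left hne).1 ?_ |>.trans derivative_one.symm
      refine (mul_eq_zero_iff_left hunit.ne_zero).1 ?_
      rw [Derivation.leibniz, smul_eq_mul, smul_eq_mul]
      linear_combination (1 - X ^ 3) * (cycleMatrix σ).det * hu' +
        (1 - X ^ 3) ^ d * u * hD - (cycleMatrix σ).det * u * hE
    · have hu0 := congrArg constantCoeff hu
      simp only [map_mul, map_pow, map_sub, map_one, constantCoeff_X] at hu0
      rw [map_mul, constantCoeff_det_cycleMatrix, map_one]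
      simpa using hu0
  calc (cycleMatrix σ).det = (cycleMatrix σ).det * ((1 - X ^ 3) ^ d * u) := by rw [hu, mul_one]
    _ = (cycleMatrix σ).det * u * (1 - X ^ 3) ^ d := by ring
    _ = _ := by rw [hc, one_mul]

end

section

/-- The permutations of `3 * d` points that are products of `d` disjoint three-cycles. -/
def threeCycleProducts (d : ℕ) : Finset (Perm (Fin (3 * d))) :=
  {τ | τ.cycleType = Multiset.replicate d 3}

theorem mem_threeCycleProducts {d : ℕ} {τ : Perm (Fin (3 * d))} :
    τ ∈ threeCycleProducts d ↔ τ.cycleType = Multiset.replicate d 3 := by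
  simp [threeCycleProducts]

/-- The generating polynomial of the numbers of cycles of `finRotate (3 * d) * τ`, where `τ` runs
over the products of `d` disjoint three-cycles. -/
noncomputable def cyclePoly (d : ℕ) : Polynomial ℚ :=
  ∑ τ ∈ threeCycleProducts d, Polynomial.X ^ orbitCount (finRotate (3 * d) * τ)

/-- The generating series of the values of `cyclePoly d` at the natural numbers. -/
noncomputable def cyclePolySeries (d : ℕ) : PowerSeries ℚ :=
  PowerSeries.mk fun N => (cyclePoly d).eval (N : ℚ)

theorem card_threeCycleProducts (d : ℕ) :
    #(threeCycleProducts d) * (3 ^ d * d.factorial) = (3 * d).factorial := by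
  have h := card_of_cycleType_mul_eq (α := Fin (3 * d)) (Multiset.replicate d 3)
  rw [if_pos] at h
  · simp only [Fintype.card_fin, Multiset.sum_replicate, smul_eq_mul, Multiset.prod_replicate,
      mul_comm d 3, Nat.sub_self, Nat.factorial_zero, one_mul] at h
    rw [← h, threeCycleProducts]
    congr 2
    rcases d.eq_zero_or_pos with rfl | hd
    · simp
    · simp [Multiset.toFinset_replicate, hd.ne']
  · refine ⟨by simp [mul_comm], fun a ha => ?_⟩
    rw [Multiset.eq_of_mem_replicate ha]
    norm_num

theorem card_threeCycleProducts_succ (d : ℕ) :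
    (#(threeCycleProducts (d + 1)) : ℚ) = (3 * d + 2) * (3 * d + 1) * #(threeCycleProducts d) := by
  have h0 := congrArg (Nat.cast (R := ℚ)) (card_threeCycleProducts d)
  have h1 := congrArg (Nat.cast (R := ℚ)) (card_threeCycleProducts (d + 1))
  have hf : (3 * (d + 1)).factorial = (3 * d + 3) * ((3 * d + 2) * ((3 * d + 1) *
      (3 * d).factorial)) := rfl
  rw [hf, Nat.factorial_succ, pow_succ] at h1
  push_cast at h0 h1
  have hne : ((3 : ℚ) ^ d * d.factorial) * (3 * (d + 1)) ≠ 0 := by positivity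
  refine mul_right_cancel₀ hne ?_
  linear_combination h1 - (3 * d + 3) * (3 * d + 2) * (3 * d + 1) * h0

theorem orbitCount_eq_one_iff_cycleType {n : ℕ} (hn : 2 ≤ n) (γ : Perm (Fin n)) :
    orbitCount γ = 1 ↔ γ.cycleType = {n} := by
  rw [orbitCount_eq_card_cycleType, Fintype.card_fin]
  have hs : γ.cycleType.sum ≤ n := by
    rw [sum_cycleType]
    simpa using card_le_univ γ.support
  constructor
  · intro h
    have hc : Multiset.card γ.cycleType ≤ 1 := by omega
    rcases Nat.le_one_iff_eq_zero_or_eq_one.1 hc with h0 | h1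
    · rw [Multiset.card_eq_zero.1 h0] at h
      simp at h
      omega
    · obtain ⟨a, ha⟩ := Multiset.card_eq_one.1 h1
      rw [ha] at h hs ⊢
      simp at h hs
      congr 1
      omega
  · intro h
    simp [h]

theorem card_filter_orbitCount_eq_one {n : ℕ} (hn : 2 ≤ n) :
    #{γ : Perm (Fin n) | orbitCount γ = 1} = (n - 1).factorial := by
  have := card_of_cycleType_singleton (α := Fin n) hn (by simp)
  simpa [orbitCount_eq_one_iff_cycleType hn] using this

open PowerSeries in
theorem sum_cycleSeries_threeCycleProducts {d : ℕ} (hd : 1 ≤ d) :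
    ∑ τ ∈ threeCycleProducts d, cycleSeries τ =
      ((3 * d - 1).factorial : ℚ⟦X⟧) * cyclePolySeries d := by
  have hn : 2 ≤ 3 * d := by omega
  have key (N : ℕ) (γ : Perm (Fin (3 * d))) (hγ : orbitCount γ = 1) :
      ∑ τ ∈ threeCycleProducts d, (N : ℚ) ^ orbitCount (τ * γ) = (cyclePoly d).eval (N : ℚ) := by
    rw [orbitCount_eq_one_iff_cycleType hn, ← cycleType_finRotate_of_le hn,
      ← isConj_iff_cycleType_eq, isConj_iff] at hγ
    obtain ⟨c, hc⟩ := hγ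
    rw [cyclePoly, Polynomial.eval_finsetSum]
    refine sum_equiv (MulAut.conj c).toEquiv ?_ ?_
    · intro τ
      simp [mem_threeCycleProducts, cycleType_conj]
    · intro τ _
      simp only [Polynomial.eval_pow, Polynomial.eval_X]
      rw [← hc, orbitCount_mul_comm _ (_ : Perm (Fin (3 * d))), ← orbitCount_conj _ c]
      congr 2
      simp [mul_assoc]
  ext N
  rw [← map_natCast (C (R := ℚ)), coeff_C_mul, map_sum, cyclePolySeries, coeff_mk]
  simp only [cycleSeries, coeff_mk]
  rw [sum_comm, sum_congr rfl fun γ hγ => key N γ (mem_filter.1 hγ).2, sum_const,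
    card_filter_orbitCount_eq_one hn, nsmul_eq_mul]

open PowerSeries in
theorem one_sub_X_pow_mul_cyclePolySeries {d : ℕ} (hd : 1 ≤ d) :
    (1 - X : ℚ⟦X⟧) ^ (2 * d + 2) * cyclePolySeries d =
      (#(threeCycleProducts d) : ℚ⟦X⟧) * X * (1 + X + X ^ 2) ^ d := by
  have : Nonempty (Fin (3 * d)) := ⟨⟨0, by omega⟩⟩
  have hτ (τ) (h : τ ∈ threeCycleProducts d) :
      (1 - X : ℚ⟦X⟧) ^ (3 * d + 2) * cycleSeries τ =
        ((3 * d - 1).factorial : ℚ⟦X⟧) * X * (1 - X ^ 3) ^ d := by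
    rw [mem_threeCycleProducts] at h
    have h3 : τ ^ 3 = 1 := by
      rw [← orderOf_dvd_iff_pow_eq_one, ← lcm_cycleType, h, Multiset.lcm_dvd]
      intro b hb
      rw [Multiset.eq_of_mem_replicate hb]
    have h1 : ∀ a, τ a ≠ a := by
      have hs : τ.support = univ := by
        rw [← card_eq_iff_eq_univ, ← sum_cycleType, h]
        simp [mul_comm]
      intro a
      rw [← mem_support, hs]
      exact mem_univ a
    have hm := one_sub_X_pow_mul_cycleSeries τ
    rwa [det_cycleMatrix_of_pow_three d (by simp) τ h3 h1, Fintype.card_fin] at hm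
  have hsum : ((3 * d - 1).factorial : ℚ⟦X⟧) * ((1 - X) ^ (3 * d + 2) * cyclePolySeries d) =
      ((3 * d - 1).factorial : ℚ⟦X⟧) *
        ((#(threeCycleProducts d) : ℚ⟦X⟧) * X * (1 - X ^ 3) ^ d) := by
    rw [mul_left_comm, ← sum_cycleSeries_threeCycleProducts hd, mul_sum, sum_congr rfl hτ,
      sum_const, nsmul_eq_mul]
    ring
  have : CharZero ℚ⟦X⟧ := algebraRat.charZero _
  have hsum' := mul_left_cancel₀ (Nat.cast_ne_zero.2 (Nat.factorial_ne_zero _)) hsum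
  refine mul_left_cancel₀ (pow_ne_zero d one_sub_X_ne_zero) ?_
  rw [show (1 - X ^ 3 : ℚ⟦X⟧) = (1 - X) * (1 + X + X ^ 2) by ring, mul_pow] at hsum'
  rw [← mul_assoc, ← pow_add, show d + (2 * d + 2) = 3 * d + 2 by ring, hsum']
  ring

theorem natDegree_cyclePoly_le {d : ℕ} (hd : 1 ≤ d) : (cyclePoly d).natDegree ≤ 2 * d + 1 := by
  set p : Polynomial ℚ := (#(threeCycleProducts d) : Polynomial ℚ) * Polynomial.X *
    (1 + Polynomial.X + Polynomial.X ^ 2) ^ d with hp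
  have hS : (p : PowerSeries ℚ) * PowerSeries.invOneSubPow ℚ (2 * d + 2) = cyclePolySeries d := by
    have h := one_sub_X_pow_mul_cyclePolySeries hd
    have hinv := (PowerSeries.invOneSubPow ℚ (2 * d + 2)).inv_val
    rw [PowerSeries.invOneSubPow_inv_eq_one_sub_pow] at hinv
    have hpc : (p : PowerSeries ℚ) = (#(threeCycleProducts d) : PowerSeries ℚ) * PowerSeries.X *
        (1 + PowerSeries.X + PowerSeries.X ^ 2) ^ d := by
      have hc : ((#(threeCycleProducts d) : Polynomial ℚ) : PowerSeries ℚ) =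
          (#(threeCycleProducts d) : PowerSeries ℚ) :=
        map_natCast (Polynomial.coeToPowerSeries.ringHom (R := ℚ)) _
      simp [hp, hc]
    rw [hpc, ← h]
    linear_combination cyclePolySeries d * hinv
  have heq : cyclePoly d = Polynomial.hilbertPoly p (2 * d + 2) := by
    refine Polynomial.eq_of_infinite_eval_eq _ _ (Set.Infinite.mono ?_
      ((Set.Ioi_infinite p.natDegree).image (Nat.cast_injective (R := ℚ)).injOn))
    rintro _ ⟨n, hn, rfl⟩
    rw [Set.mem_ofPred_eq, ← Polynomial.coeff_mul_invOneSubPow_eq_hilbertPoly_eval _ hn, hS,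
      cyclePolySeries, PowerSeries.coeff_mk]
  rw [heq, Polynomial.hilbertPoly_succ]
  refine Polynomial.natDegree_sum_le_of_forall_le _ _ fun i _ => ?_
  exact (Polynomial.natDegree_smul_le _ _).trans (Polynomial.natDegree_preHilbertPoly ℚ _ _).le

end

section

open PowerSeries in
theorem derivative_natCast (k : ℕ) : derivative ℚ (k : ℚ⟦X⟧) = 0 := by
  rw [← map_natCast (C (R := ℚ)), derivative_C]

open PowerSeries in
/-- If `(1 - X) ^ m * T = P`, this expresses `(X * d/dX)² T` through the derivatives of `P`. -/
theorem one_sub_X_pow_mul_derivative_derivative {m : ℕ} {T P : ℚ⟦X⟧} (h : (1 - X) ^ m * T = P) :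
    (1 - X) ^ (m + 2) * (X * derivative ℚ (X * derivative ℚ T)) =
      X * (1 - X) * ((1 - X) * derivative ℚ P + (m : ℚ⟦X⟧) * P) +
        X ^ 2 * ((1 - X) ^ 2 * derivative ℚ (derivative ℚ P) +
          2 * (m : ℚ⟦X⟧) * (1 - X) * derivative ℚ P + (m : ℚ⟦X⟧) * ((m : ℚ⟦X⟧) + 1) * P) := by
  have hv (k : ℕ) : (1 - X) * derivative ℚ ((1 - X : ℚ⟦X⟧) ^ k) =
      -((k : ℚ⟦X⟧) * (1 - X) ^ k) := by
    cases k with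
    | zero => simp
    | succ k =>
      simp only [Derivation.leibniz_pow, smul_eq_mul, map_sub, derivative_X, derivative_one,
        nsmul_eq_mul]
      push_cast
      ring
  have h1 := congrArg (derivative ℚ) h
  simp only [Derivation.leibniz, smul_eq_mul] at h1
  have h1' : (1 - X) ^ (m + 1) * derivative ℚ T = (1 - X) * derivative ℚ P + (m : ℚ⟦X⟧) * P := by
    linear_combination (1 - X) * h1 - T * hv m + (m : ℚ⟦X⟧) * h
  have h2 := congrArg (derivative ℚ) h1'
  simp only [Derivation.leibniz, smul_eq_mul, map_add, map_sub, derivative_X, derivative_one,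
    derivative_natCast] at h2
  have hv1 := hv (m + 1)
  push_cast at hv1
  simp only [Derivation.leibniz, smul_eq_mul, derivative_X]
  linear_combination X * (1 - X) * h1' + X ^ 2 * (1 - X) * h2 - X ^ 2 * derivative ℚ T * hv1 +
    X ^ 2 * ((m : ℚ⟦X⟧) + 1) * h1'

open PowerSeries in
theorem derivative_one_add_X_add_X_sq_pow_succ (n : ℕ) :
    derivative ℚ ((1 + X + X ^ 2 : ℚ⟦X⟧) ^ (n + 1)) =
      ((n : ℚ⟦X⟧) + 1) * (1 + 2 * X) * (1 + X + X ^ 2) ^ n := by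
  simp only [Derivation.leibniz_pow, smul_eq_mul, map_add, derivative_X, derivative_one,
    nsmul_eq_mul, Nat.add_sub_cancel]
  push_cast
  ring

open PowerSeries in
theorem derivative_natCast_mul_X_mul_pow (k n : ℕ) :
    derivative ℚ ((k : ℚ⟦X⟧) * X * (1 + X + X ^ 2) ^ (n + 1)) =
      (k : ℚ⟦X⟧) * ((1 + X + X ^ 2) ^ (n + 1) +
        ((n : ℚ⟦X⟧) + 1) * X * (1 + 2 * X) * (1 + X + X ^ 2) ^ n) := by
  rw [Derivation.leibniz, Derivation.leibniz, derivative_natCast,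
    derivative_one_add_X_add_X_sq_pow_succ]
  simp only [smul_eq_mul, derivative_X]
  ring

open PowerSeries in
theorem derivative_derivative_natCast_mul_X_mul_pow (k n : ℕ) :
    derivative ℚ (derivative ℚ ((k : ℚ⟦X⟧) * X * (1 + X + X ^ 2) ^ (n + 2))) =
      (k : ℚ⟦X⟧) * (((n : ℚ⟦X⟧) + 2) * (2 + 6 * X) * (1 + X + X ^ 2) ^ (n + 1) +
        ((n : ℚ⟦X⟧) + 2) * ((n : ℚ⟦X⟧) + 1) * X * (1 + 2 * X) ^ 2 * (1 + X + X ^ 2) ^ n) := by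
  have h2 : derivative ℚ (2 : ℚ⟦X⟧) = 0 := derivative_natCast 2
  rw [derivative_natCast_mul_X_mul_pow]
  simp only [Derivation.leibniz _ _ _, map_add, smul_eq_mul, derivative_X, derivative_natCast,
    derivative_one, derivative_one_add_X_add_X_sq_pow_succ, h2]
  push_cast
  ring

open PowerSeries in
theorem cyclePolySeries_recursion {n : ℕ} (hn : 1 ≤ n) :
    2 * ((n : ℚ⟦X⟧) + 3) * (2 * (n : ℚ⟦X⟧) + 7) * cyclePolySeries (n + 3) =
      3 * (3 * (n : ℚ⟦X⟧) + 8) * (3 * (n : ℚ⟦X⟧) + 7) *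
          (X * derivative ℚ (X * derivative ℚ (cyclePolySeries (n + 2)))) +
        (3 * (n : ℚ⟦X⟧) + 8) * (3 * (n : ℚ⟦X⟧) + 7) *
          (9 * ((n : ℚ⟦X⟧) + 3) ^ 2 - 8 * ((n : ℚ⟦X⟧) + 3) + 2) * cyclePolySeries (n + 2) -
        ((n : ℚ⟦X⟧) + 2) * (3 * (n : ℚ⟦X⟧) + 8) * (3 * (n : ℚ⟦X⟧) + 7) * (3 * (n : ℚ⟦X⟧) + 5) *
          (3 * (n : ℚ⟦X⟧) + 4) * (6 * (n : ℚ⟦X⟧) + 11) * cyclePolySeries (n + 1) +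
        ((n : ℚ⟦X⟧) + 2) * ((n : ℚ⟦X⟧) + 1) * (3 * (n : ℚ⟦X⟧) + 8) * (3 * (n : ℚ⟦X⟧) + 7) *
          (3 * (n : ℚ⟦X⟧) + 5) * (3 * (n : ℚ⟦X⟧) + 4) * (3 * (n : ℚ⟦X⟧) + 2) *
          (3 * (n : ℚ⟦X⟧) + 1) * cyclePolySeries n := by
  have hc (k : ℕ) : (#(threeCycleProducts (k + 1)) : ℚ⟦X⟧) =
      (3 * (k : ℚ⟦X⟧) + 2) * (3 * (k : ℚ⟦X⟧) + 1) * (#(threeCycleProducts k) : ℚ⟦X⟧) := by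
    have h := congrArg (C (R := ℚ)) (card_threeCycleProducts_succ k)
    simp only [map_mul, map_add, map_natCast, map_one, map_ofNat] at h
    exact h
  have c1 := hc n
  have c2 := hc (n + 1)
  have c3 := hc (n + 2)
  push_cast at c2 c3
  rw [c1] at c2
  rw [c2] at c3
  have s0 := one_sub_X_pow_mul_cyclePolySeries hn
  have s1 := one_sub_X_pow_mul_cyclePolySeries (d := n + 1) (by omega)
  have s2 := one_sub_X_pow_mul_cyclePolySeries (d := n + 2) (by omega)
  have s3 := one_sub_X_pow_mul_cyclePolySeries (d := n + 3) (by omega)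
  have t2 := one_sub_X_pow_mul_derivative_derivative s2
  rw [derivative_derivative_natCast_mul_X_mul_pow, derivative_natCast_mul_X_mul_pow] at t2
  push_cast at t2
  rw [c1] at s1
  rw [c2] at s2 t2
  rw [c3] at s3
  refine mul_left_cancel₀ (pow_ne_zero (2 * n + 8) one_sub_X_ne_zero) ?_
  generalize X * derivative ℚ (X * derivative ℚ (cyclePolySeries (n + 2))) = D at *
  generalize cyclePolySeries (n + 3) = S3 at *
  generalize cyclePolySeries (n + 2) = S2 at *
  generalize cyclePolySeries (n + 1) = S1 at *
  generalize cyclePolySeries n = S0 at *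
  generalize (#(threeCycleProducts n) : ℚ⟦X⟧) = c at *
  clear c1 c2 c3 hc
  generalize (n : ℚ⟦X⟧) = N at *
  linear_combination 2 * (N + 3) * (2 * N + 7) * s3 -
    3 * (3 * N + 8) * (3 * N + 7) * t2 -
    (3 * N + 8) * (3 * N + 7) * (9 * (N + 3) ^ 2 - 8 * (N + 3) + 2) * (1 - X) ^ 2 * s2 +
    (N + 2) * (3 * N + 8) * (3 * N + 7) * (3 * N + 5) * (3 * N + 4) * (6 * N + 11) *
      (1 - X) ^ 4 * s1 -
    (N + 2) * (N + 1) * (3 * N + 8) * (3 * N + 7) * (3 * N + 5) * (3 * N + 4) * (3 * N + 2) *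
      (3 * N + 1) * (1 - X) ^ 6 * s0

end

section

open PowerSeries in
theorem coeff_X_mul_derivative (f : ℚ⟦X⟧) (N : ℕ) :
    coeff N (X * derivative ℚ f) = N * coeff N f := by
  cases N with
  | zero => simp
  | succ N =>
    rw [coeff_succ_X_mul, coeff_derivative]
    push_cast
    ring

open Polynomial in
theorem cyclePoly_recursion {n : ℕ} (hn : 1 ≤ n) :
    C (2 * ((n : ℚ) + 3) * (2 * n + 7)) * cyclePoly (n + 3) =
      C (3 * (3 * (n : ℚ) + 8) * (3 * n + 7)) * (X ^ 2 * cyclePoly (n + 2)) +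
        C ((3 * (n : ℚ) + 8) * (3 * n + 7) * (9 * (n + 3) ^ 2 - 8 * (n + 3) + 2)) *
          cyclePoly (n + 2) -
        C (((n : ℚ) + 2) * (3 * n + 8) * (3 * n + 7) * (3 * n + 5) * (3 * n + 4) * (6 * n + 11)) *
          cyclePoly (n + 1) +
        C (((n : ℚ) + 2) * (n + 1) * (3 * n + 8) * (3 * n + 7) * (3 * n + 5) * (3 * n + 4) *
          (3 * n + 2) * (3 * n + 1)) * cyclePoly n := by
  refine eq_of_infinite_eval_eq _ _ (Set.Infinite.mono ?_
    (Set.infinite_range_of_injective (Nat.cast_injective (R := ℚ))))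
  rintro _ ⟨N, rfl⟩
  have h := congrArg (PowerSeries.coeff N) (cyclePolySeries_recursion hn)
  have hC (a : ℚ) (k : ℕ) : PowerSeries.coeff N (PowerSeries.C a * cyclePolySeries k) =
      a * (cyclePoly k).eval (N : ℚ) := by
    rw [PowerSeries.coeff_C_mul, cyclePolySeries, PowerSeries.coeff_mk]
  have hD (a : ℚ) (k : ℕ) : PowerSeries.coeff N (PowerSeries.C a * (PowerSeries.X *
      PowerSeries.derivative ℚ (PowerSeries.X * PowerSeries.derivative ℚ (cyclePolySeries k)))) =
      a * (N ^ 2 * (cyclePoly k).eval (N : ℚ)) := by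
    rw [PowerSeries.coeff_C_mul, coeff_X_mul_derivative, coeff_X_mul_derivative, cyclePolySeries,
      PowerSeries.coeff_mk]
    ring
  have h0 := hC (2 * ((n : ℚ) + 3) * (2 * n + 7)) (n + 3)
  have h1 := hD (3 * (3 * (n : ℚ) + 8) * (3 * n + 7)) (n + 2)
  have h2 := hC ((3 * (n : ℚ) + 8) * (3 * n + 7) * (9 * (n + 3) ^ 2 - 8 * (n + 3) + 2)) (n + 2)
  have h3 := hC (((n : ℚ) + 2) * (3 * n + 8) * (3 * n + 7) * (3 * n + 5) * (3 * n + 4) *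
    (6 * n + 11)) (n + 1)
  have h4 := hC (((n : ℚ) + 2) * (n + 1) * (3 * n + 8) * (3 * n + 7) * (3 * n + 5) * (3 * n + 4) *
    (3 * n + 2) * (3 * n + 1)) n
  simp only [map_mul PowerSeries.C, map_add PowerSeries.C, map_sub PowerSeries.C,
    map_pow PowerSeries.C, map_natCast PowerSeries.C, map_ofNat PowerSeries.C,
    map_one PowerSeries.C] at h0 h1 h2 h3 h4
  rw [map_add, map_sub, map_add, h0, h1, h2, h3, h4] at h
  simpa only [Set.mem_ofPred_eq, eval_add, eval_sub, eval_mul, eval_C, eval_pow, eval_X] using h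

theorem cycleCount_eq_orbitCount {n : ℕ} (σ : Perm (Fin n)) : cycleCount σ = orbitCount σ := by
  rw [orbitCount_eq_card_cycleType, Fintype.card_fin, cycleCount]

theorem coeff_cyclePoly (d c : ℕ) :
    (cyclePoly d).coeff c = Nat.card {τ : Perm (Fin (3 * d)) //
      τ.cycleType = Multiset.replicate d 3 ∧ cycleCount (finRotate (3 * d) * τ) = c} := by
  simp only [cyclePoly, Polynomial.finsetSum_coeff, Polynomial.coeff_X_pow, sum_boole,
    threeCycleProducts, filter_filter, Nat.card_eq_fintype_card, Fintype.card_subtype,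
    cycleCount_eq_orbitCount, eq_comm (a := c)]

theorem a3_eq_coeff_cyclePoly {g : ℤ} {d c : ℕ} (hd : 1 ≤ d) (hc : (c : ℤ) = 2 * d + 1 - 2 * g) :
    (a3 g d : ℚ) = (cyclePoly d).coeff c := by
  rw [a3]
  split_ifs with hg
  · rw [Polynomial.coeff_eq_zero_of_natDegree_lt, Int.cast_zero]
    have := natDegree_cyclePoly_le hd
    omega
  · rw [coeff_cyclePoly, ← hc]
    norm_cast

theorem a3_eq_zero {g : ℤ} {d : ℕ} (h : 2 * (d : ℤ) + 1 - 2 * g < 0) : a3 g d = 0 := by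
  rw [a3]
  split_ifs
  · rfl
  · rw [Nat.cast_eq_zero, Nat.card_eq_zero]
    refine Or.inl ⟨fun τ => ?_⟩
    have := τ.2.2
    omega

theorem a3_recursion (g : ℤ) {n : ℕ} (hn : 1 ≤ n) :
    2 * ((n : ℤ) + 3) * (2 * n + 7) * a3 g (n + 3) =
      3 * (3 * (n : ℤ) + 8) * (3 * n + 7) * a3 g (n + 2) +
        (3 * (n : ℤ) + 8) * (3 * n + 7) * (9 * (n + 3) ^ 2 - 8 * (n + 3) + 2) *
          a3 (g - 1) (n + 2) -
        ((n : ℤ) + 2) * (3 * n + 8) * (3 * n + 7) * (3 * n + 5) * (3 * n + 4) * (6 * n + 11) *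
          a3 (g - 2) (n + 1) +
        ((n : ℤ) + 2) * (n + 1) * (3 * n + 8) * (3 * n + 7) * (3 * n + 5) * (3 * n + 4) *
          (3 * n + 2) * (3 * n + 1) * a3 (g - 3) n := by
  rcases lt_or_ge (2 * (n : ℤ) + 7 - 2 * g) 0 with h | h
  · rw [a3_eq_zero (d := n + 3), a3_eq_zero (d := n + 2), a3_eq_zero (d := n + 2),
      a3_eq_zero (d := n + 1), a3_eq_zero (d := n)]
    · ring
    all_goals push_cast; omega
  obtain ⟨c, hc⟩ := Int.eq_ofNat_of_zero_le h
  have key := congrArg (fun p => Polynomial.coeff p c) (cyclePoly_recursion hn)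
  have e0 : (a3 g (n + 3) : ℚ) = (cyclePoly (n + 3)).coeff c :=
    a3_eq_coeff_cyclePoly (by omega) (by push_cast; omega)
  have e1 : (a3 g (n + 2) : ℚ) = (Polynomial.X ^ 2 * cyclePoly (n + 2)).coeff c := by
    rw [Polynomial.coeff_X_pow_mul']
    split_ifs with h2
    · exact a3_eq_coeff_cyclePoly (by omega) (by push_cast; omega)
    · rw [a3_eq_zero (by push_cast; omega), Int.cast_zero]
  have e2 : (a3 (g - 1) (n + 2) : ℚ) = (cyclePoly (n + 2)).coeff c :=
    a3_eq_coeff_cyclePoly (by omega) (by push_cast; omega)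
  have e3 : (a3 (g - 2) (n + 1) : ℚ) = (cyclePoly (n + 1)).coeff c :=
    a3_eq_coeff_cyclePoly (by omega) (by push_cast; omega)
  have e4 : (a3 (g - 3) n : ℚ) = (cyclePoly n).coeff c :=
    a3_eq_coeff_cyclePoly hn (by omega)
  simp only [Polynomial.coeff_add, Polynomial.coeff_sub, Polynomial.coeff_C_mul, ← e0, ← e1, ← e2,
    ← e3, ← e4] at key
  exact_mod_cast key

end

end Equiv.Perm

end

/-- The 1-point recursion for the enumeration of 3-hypermaps. -/
theorem one_point_recursion_3hypermaps (g : ℤ) (d : ℕ) (hg : 0 ≤ g) (hd : 4 ≤ d) :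
    2 * (d : ℤ) * (2 * (d : ℤ) + 1) * a3 g d =
      3 * (3 * (d : ℤ) - 1) * (3 * (d : ℤ) - 2) * a3 g (d - 1) +
        (3 * (d : ℤ) - 1) * (3 * (d : ℤ) - 2) * (9 * (d : ℤ) ^ 2 - 8 * (d : ℤ) + 2) *
          a3 (g - 1) (d - 1) -
        ((d : ℤ) - 1) * (3 * (d : ℤ) - 1) * (3 * (d : ℤ) - 2) * (3 * (d : ℤ) - 4) *
          (3 * (d : ℤ) - 5) * (6 * (d : ℤ) - 7) * a3 (g - 2) (d - 2) +
        ((d : ℤ) - 1) * ((d : ℤ) - 2) * (3 * (d : ℤ) - 1) * (3 * (d : ℤ) - 2) *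
          (3 * (d : ℤ) - 4) * (3 * (d : ℤ) - 5) * (3 * (d : ℤ) - 7) * (3 * (d : ℤ) - 8) *
          a3 (g - 3) (d - 3) := by
  obtain ⟨n, rfl⟩ := Nat.exists_eq_add_of_le' (show 3 ≤ d by omega)
  have h := Equiv.Perm.a3_recursion g (n := n) (by omega)
  rw [show n + 3 - 1 = n + 2 by omega, show n + 3 - 2 = n + 1 by omega,
    show n + 3 - 3 = n by omega]
  push_cast
  linear_combination h
end
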